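/- arXiv:2309.05011 — 3 statements merged into one kernel-verified Lean document; each statement's English description precedes it below -/
import Mathlib

section
/- Let G be a finite simple graph on vertex set {x_1,…,x_n} that has a leaf edge (an edge containing a vertex of degree one), and let I(G) ⊆ S = k[x_1,…,x_n] be its edge ideal. Then the sequence (depth(S/I(G)^t))_{t ≥ 1} is non-increasing, i.e., depth(S/I(G)^t) ≤ depth(S/I(G)^{t−1}) for all t ≥ 2. -/
open MvPolynomial

/-- The maximal homogeneous ideal of the polynomial ring, generated by all variables. -/
noncomputable def maxHomIdeal (k : Type) [Field k] (V : Type) : Ideal (MvPolynomial V k) :=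
  Ideal.span (Set.range (X : V → MvPolynomial V k))

/-- `depthQuot k I` is the depth of `S/I` where `S = k[x_v : v ∈ V]`, defined as
`min {i : H^i_m(S/I) ≠ 0}` where `m` is the maximal homogeneous ideal and `H^i_m` is
local cohomology. -/
noncomputable def depthQuot (k : Type) [Field k] {V : Type} (I : Ideal (MvPolynomial V k)) : ℕ :=
  sInf {i : ℕ |
    Nontrivial ((localCohomology (maxHomIdeal k V) i).obj
      (ModuleCat.of (MvPolynomial V k) (MvPolynomial V k ⧸ I)))}

/-- The edge ideal of a simple graph `G`, generated by the monomials `x_i x_j` for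
edges `{i, j}` of `G`. -/
noncomputable def edgeIdeal (k : Type) [Field k] {V : Type} (G : SimpleGraph V) :
    Ideal (MvPolynomial V k) :=
  Ideal.span {p | ∃ i j, G.Adj i j ∧ p = X i * X j}

section

open CategoryTheory Limits Opposite Abelian

universe u
variable {R : Type u} [CommRing R] {N N' M : ModuleCat.{u} R}

/-- The complex `Hom(P, M)` of a projective resolution `P`, in the opposite category. -/
noncomputable abbrev homComplexOp (M : ModuleCat.{u} R) (P : ProjectiveResolution N) :
    ChainComplex (ModuleCat.{u} R)ᵒᵖ ℕ :=
  ((((linearYoneda R (ModuleCat.{u} R)).obj M).rightOp).mapHomologicalComplex _).obj P.complex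

/-- The map from `n`-cocycles of `Hom(P, M)` to `Ext^n(N, M)`. -/
noncomputable def extRepr (P : ProjectiveResolution N) (n : ℕ) :
    ((homComplexOp M P).opcycles n).unop ⟶ ((Ext R (ModuleCat.{u} R) n).obj (op N)).obj M :=
  ((homComplexOp M P).homologyι n).unop ≫ (P.isoLeftDerivedObj _ n).hom.unop

/-- The inclusion of the `n`-cocycles of `Hom(P, M)` into `Hom(P_n, M)`. -/
noncomputable def extCocycle (P : ProjectiveResolution N) (n : ℕ) :
    ((homComplexOp M P).opcycles n).unop ⟶ ((homComplexOp M P).X n).unop :=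
  ((homComplexOp M P).pOpcycles n).unop

lemma extRepr_surjective (P : ProjectiveResolution N) (n : ℕ) :
    Function.Surjective (extRepr (M := M) P n) := by
  have h1 : Function.Surjective ((homComplexOp M P).homologyι n).unop := by
    rw [← ModuleCat.epi_iff_surjective]
    infer_instance
  have h2 : Function.Surjective
      ((P.isoLeftDerivedObj ((linearYoneda R (ModuleCat.{u} R)).obj M).rightOp n).hom.unop) := by
    rw [← ModuleCat.epi_iff_surjective]
    infer_instance
  exact h2.comp h1

lemma extCocycle_injective (P : ProjectiveResolution N) (n : ℕ) :
    Function.Injective (extCocycle (M := M) P n) := by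
  rw [← ModuleCat.mono_iff_injective]
  unfold extCocycle
  infer_instance

lemma d_comp_extCocycle (P : ProjectiveResolution N) (n m : ℕ)
    (w : ((homComplexOp M P).opcycles n).unop) :
    P.complex.d m n ≫ (show P.complex.X n ⟶ M from extCocycle P n w) = 0 := by
  have h := (homComplexOp M P).d_pOpcycles m n
  have h2 := ConcreteCategory.congr_hom (congr_arg Quiver.Hom.unop h) w
  exact h2

lemma exists_extCocycle_eq (P : ProjectiveResolution N) (n : ℕ) (z : P.complex.X n ⟶ M)
    (hz : P.complex.d (n + 1) n ≫ z = 0) :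
    ∃ w, extCocycle (M := M) P n w = z := by
  have h := ShortComplex.exact_of_g_is_cokernel
    (.mk _ _ ((homComplexOp M P).d_pOpcycles (n + 1) n))
    ((homComplexOp M P).opcyclesIsCokernel (n + 1) n (by simp))
  have h2 := (ShortComplex.moduleCat_exact_iff _).1 h.unop z hz
  exact h2

lemma extRepr_eq_zero_iff (P : ProjectiveResolution N) (n : ℕ)
    (w : ((homComplexOp M P).opcycles n).unop) :
    extRepr P n w = 0 ↔ ∃ g : P.complex.X ((ComplexShape.down ℕ).next n) ⟶ M,
      P.complex.d n _ ≫ g = extCocycle P n w := by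
  have h := ShortComplex.exact_of_f_is_kernel
    (.mk _ _ ((homComplexOp M P).homologyι_comp_fromOpcycles n
      ((ComplexShape.down ℕ).next n)))
    ((homComplexOp M P).homologyIsKernel n _ rfl)
  have h2 := (ShortComplex.moduleCat_exact_iff _).1 h.unop w
  have h0 : extRepr P n w = 0 ↔ ((homComplexOp M P).homologyι n).unop w = 0 := by
    let F := ((linearYoneda R (ModuleCat.{u} R)).obj M).rightOp
    have : Function.Injective (P.isoLeftDerivedObj F n).hom.unop := by
      rw [← ModuleCat.mono_iff_injective]
      infer_instance
    exact map_eq_zero_iff (P.isoLeftDerivedObj F n).hom.unop.hom this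
  have hd : ∀ g : P.complex.X ((ComplexShape.down ℕ).next n) ⟶ M,
      extCocycle P n (((homComplexOp M P).fromOpcycles n ((ComplexShape.down ℕ).next n)).unop g) =
      P.complex.d n _ ≫ g := by
    intro g
    exact ConcreteCategory.congr_hom (congr_arg Quiver.Hom.unop
      ((homComplexOp M P).p_fromOpcycles n ((ComplexShape.down ℕ).next n))) g
  rw [h0]
  constructor
  · intro hw
    obtain ⟨g, hg⟩ := h2 hw
    exact ⟨g, (hd g).symm.trans (congr_arg _ hg)⟩
  · rintro ⟨g, hg⟩
    rw [← hd] at hg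
    rw [← extCocycle_injective _ _ hg]
    exact ConcreteCategory.congr_hom (congr_arg Quiver.Hom.unop
      ((homComplexOp M P).homologyι_comp_fromOpcycles n ((ComplexShape.down ℕ).next n))) g

lemma extRepr_naturality (P : ProjectiveResolution N) (P' : ProjectiveResolution N') (f : N' ⟶ N)
    (φ : ProjectiveResolution.Hom P' P f) (n : ℕ) (w : ((homComplexOp M P).opcycles n).unop) :
    ∃ w' : ((homComplexOp M P').opcycles n).unop,
      extCocycle P' n w' = φ.hom.f n ≫ (show P.complex.X n ⟶ M from extCocycle P n w) ∧
      extRepr P' n w' = ((Ext R (ModuleCat.{u} R) n).map f.op).app M (extRepr P n w) := by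
  let F := ((linearYoneda R (ModuleCat.{u} R)).obj M).rightOp
  let ψ : homComplexOp M P' ⟶ homComplexOp M P := (F.mapHomologicalComplex _).map φ.hom
  refine ⟨(HomologicalComplex.opcyclesMap ψ n).unop w, ?_, ?_⟩
  · exact ConcreteCategory.congr_hom
      (congr_arg Quiver.Hom.unop (HomologicalComplex.p_opcyclesMap ψ n)) w
  · have h1 := ProjectiveResolution.isoLeftDerivedObj_hom_naturality f P' P φ.hom
      (by simpa using φ.hom_f_zero_comp_π_f_zero) F n
    have h2 := HomologicalComplex.homologyι_naturality ψ n
    have h1' := fun y => ConcreteCategory.congr_hom (congr_arg Quiver.Hom.unop h1) y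
    have h2' := ConcreteCategory.congr_hom (congr_arg Quiver.Hom.unop h2) w
    refine Eq.trans ?_ (h1' _).symm
    exact congr_arg (P'.isoLeftDerivedObj F n).hom.unop h2'.symm

lemma extMk_eq_zero_iff_next (P : ProjectiveResolution N) (n : ℕ) (z : P.complex.X n ⟶ M)
    (hz : P.complex.d (n + 1) n ≫ z = 0) :
    P.extMk z (n + 1) rfl hz = 0 ↔ ∃ g : P.complex.X ((ComplexShape.down ℕ).next n) ⟶ M,
      P.complex.d n _ ≫ g = z := by
  cases n with
  | zero =>
    have hd : ∀ m, P.complex.d 0 m = 0 := fun m => P.complex.shape _ _ (by simp)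
    simp only [hd, Limits.zero_comp]
    constructor
    · intro h
      rw [← P.extEquivCohomologyClass.apply_eq_iff_eq,
        ProjectiveResolution.extEquivCohomologyClass_extMk,
        ProjectiveResolution.extEquivCohomologyClass_zero,
        CochainComplex.HomComplex.CohomologyClass.mk_eq_zero_iff,
        CochainComplex.HomComplex.Cocycle.toSingleMk_mem_coboundaries_iff _ _ _ _ _ 1
          (by simp)] at h
      obtain ⟨g, hg⟩ := h
      have : g = 0 := (P.cochainComplex.isZero_of_isStrictlyLE 0 1).eq_of_src _ _
      rw [this, Limits.comp_zero] at hg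
      refine ⟨0, ?_⟩
      rw [← cancel_epi (P.cochainComplexXIso (-(0:ℕ)) 0 rfl).hom, ← hg, Limits.comp_zero]
    · rintro ⟨-, rfl⟩
      simp
  | succ n =>
    rw [P.extMk_eq_zero_iff z _ rfl hz n rfl]
    have h : (ComplexShape.down ℕ).next (n + 1) = n := by simp
    rw [h]

/-- The classes `x` and `y` are represented by a common cocycle of the resolution `P`. -/
def ExtRel (P : ProjectiveResolution N) (n : ℕ) (x : ((Ext R (ModuleCat.{u} R) n).obj (op N)).obj M)
    (y : Abelian.Ext N M n) : Prop :=
  ∃ (w : ((homComplexOp M P).opcycles n).unop) (z : P.complex.X n ⟶ M)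
    (hz : P.complex.d (n + 1) n ≫ z = 0),
    extCocycle P n w = z ∧ extRepr P n w = x ∧ P.extMk z (n + 1) rfl hz = y

lemma ExtRel.exists_right (P : ProjectiveResolution N) (n : ℕ)
    (x : ((Ext R (ModuleCat.{u} R) n).obj (op N)).obj M) : ∃ y, ExtRel P n x y := by
  obtain ⟨w, hw⟩ := extRepr_surjective P n x
  exact ⟨_, w, _, d_comp_extCocycle P n (n + 1) w, rfl, hw, rfl⟩

lemma ExtRel.exists_left (P : ProjectiveResolution N) (n : ℕ)
    (y : Abelian.Ext N M n) : ∃ x, ExtRel P n x y := by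
  obtain ⟨z, hz, hy⟩ := P.extMk_surjective y (n + 1) rfl
  obtain ⟨w, hw⟩ := exists_extCocycle_eq P n z hz
  exact ⟨_, w, z, hz, hw, rfl, hy⟩

lemma ExtRel.eq_zero_iff {P : ProjectiveResolution N} {n : ℕ}
    {x : ((Ext R (ModuleCat.{u} R) n).obj (op N)).obj M} {y : Abelian.Ext N M n}
    (h : ExtRel P n x y) : x = 0 ↔ y = 0 := by
  obtain ⟨w, z, hz, rfl, rfl, rfl⟩ := h
  exact (extRepr_eq_zero_iff P n w).trans (extMk_eq_zero_iff_next P n _ hz).symm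

lemma ExtRel.map {P : ProjectiveResolution N} {n : ℕ}
    {x : ((Ext R (ModuleCat.{u} R) n).obj (op N)).obj M} {y : Abelian.Ext N M n}
    (h : ExtRel P n x y) (P' : ProjectiveResolution N') (f : N' ⟶ N) :
    ExtRel P' n (((Ext R (ModuleCat.{u} R) n).map f.op).app M x)
      ((Ext.mk₀ f).comp y (zero_add n)) := by
  obtain ⟨w, z, hz, rfl, rfl, rfl⟩ := h
  let φ : ProjectiveResolution.Hom P' P f :=
    { hom := ProjectiveResolution.lift f P' P
      hom_f_zero_comp_π_f_zero := by
        simpa using ProjectiveResolution.lift_commutes_zero f P' P }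
  obtain ⟨w', h1, h2⟩ := extRepr_naturality P P' f φ n w
  exact ⟨w', _, _, h1, h2, (ProjectiveResolution.mk₀_comp_extMk _ _ rfl hz φ).symm⟩

end

section

open CategoryTheory Limits Opposite Abelian

variable {R : Type} [CommRing R]

/-- The projection `R ⧸ I ⟶ R ⧸ I'` for `I ≤ I'`. -/
noncomputable abbrev quotProj {I I' : Ideal R} (h : I ≤ I') :
    ModuleCat.of R (R ⧸ I) ⟶ ModuleCat.of R (R ⧸ I') :=
  ModuleCat.ofHom (Submodule.mapQ _ _ LinearMap.id h)

/-- Every class in `Ext^i(R ⧸ J^t, M)` dies after pulling it back to some `R ⧸ J^s`. -/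
def ExtVanishes (J : Ideal R) (i : ℕ) (M : ModuleCat.{0} R) : Prop :=
  ∀ (t : ℕ) (x : Abelian.Ext (ModuleCat.of R (R ⧸ J ^ t)) M i), ∃ (s : ℕ) (h : t ≤ s),
    (Ext.mk₀ (quotProj (Ideal.pow_le_pow_right (I := J) h))).comp x (zero_add i) = 0

lemma subsingleton_colimit_iff {D : Type} [SmallCategory D] [IsFiltered D]
    (F : D ⥤ ModuleCat.{0} R) :
    Subsingleton (colimit F : ModuleCat.{0} R) ↔
      ∀ j (x : F.obj j), ∃ (j' : D) (f : j ⟶ j'), F.map f x = 0 := by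
  constructor
  · intro h j x
    exact Concrete.colimit_rep_eq_zero R F j x (Subsingleton.elim _ _)
  · intro h
    refine subsingleton_of_forall_eq 0 fun x => ?_
    obtain ⟨j, x, rfl⟩ := Concrete.colimit_exists_rep F x
    obtain ⟨j', f, hf⟩ := h j x
    rw [← colimit.w F f]
    change (colimit.ι F j') (F.map f x) = 0
    rw [hf, map_zero]

lemma subsingleton_localCohomology_iff (J : Ideal R) (i : ℕ) (M : ModuleCat.{0} R) :
    Subsingleton ((localCohomology J i).obj M) ↔ ExtVanishes J i M := by
  let F := localCohomology.diagram (localCohomology.idealPowersDiagram J) i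
  have e : (localCohomology J i).obj M ≅ colimit (F ⋙ (evaluation _ _).obj M) :=
    colimitObjIsoColimitCompEvaluation F M
  have : IsFiltered (ℕᵒᵖᵒᵖ) := IsFiltered.of_equivalence (opOpEquivalence ℕ).symm
  rw [e.toLinearEquiv.toEquiv.subsingleton_congr, subsingleton_colimit_iff]
  have key (t s : ℕ) (h : t ≤ s) (x : ((Ext R (ModuleCat.{0} R) i).obj
      (op (ModuleCat.of R (R ⧸ J ^ t)))).obj M) (y)
      (hxy : ExtRel (projectiveResolution _) i x y) :
      (F.map (show op (op t) ⟶ op (op s) from (homOfLE h).op.op)).app M x = 0 ↔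
       (Ext.mk₀ (quotProj (Ideal.pow_le_pow_right (I := J) h))).comp y (zero_add i) = 0 :=
    (hxy.map (projectiveResolution _) (quotProj (Ideal.pow_le_pow_right h))).eq_zero_iff
  constructor
  · intro h t y
    obtain ⟨x, hx⟩ := ExtRel.exists_left (projectiveResolution _) i y
    obtain ⟨j, f, hf⟩ := h (op (op t)) x
    exact ⟨j.unop.unop, leOfHom f.unop.unop, (key t _ _ x y hx).1 hf⟩
  · intro h j x
    obtain ⟨y, hy⟩ := ExtRel.exists_right (projectiveResolution _) i x
    obtain ⟨s, hs, h⟩ := h j.unop.unop y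
    exact ⟨op (op s), _, (key _ s hs x y hy).2 h⟩

end

section

open CategoryTheory Limits Opposite Abelian

universe w w' v v' u u'
variable {C : Type u} [Category.{v} C] [Abelian C]
variable {D : Type u'} [Category.{v'} D] [Abelian D] [HasExt.{w} C] [HasExt.{w'} D]
variable {F : C ⥤ D} {G : D ⥤ C} (adj : F ⊣ G) [F.Additive] [PreservesFiniteLimits F]
  [PreservesFiniteColimits F]

/-- The comparison `Ext^n(X, G Y) → Ext^n(F X, Y)` for an adjunction `F ⊣ G` with `F` exact. -/
noncomputable def adjExt (X : C) (Y : D) (n : ℕ) : Ext X (G.obj Y) n →+ Ext (F.obj X) Y n :=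
  ((Ext.mk₀ (adj.counit.app Y)).postcomp (F.obj X) (add_zero n)).comp
    (F.mapExtAddHom X (G.obj Y) n)

lemma adjExt_apply (X : C) (Y : D) (n : ℕ) (x : Ext X (G.obj Y) n) :
    adjExt adj X Y n x =
      (x.mapExactFunctor F).comp (Ext.mk₀ (adj.counit.app Y)) (add_zero n) := rfl

lemma adjExt_comp {X' X : C} (Y : D) {m n p : ℕ} (f : Ext X' X m) (x : Ext X (G.obj Y) n)
    (h : m + n = p) :
    adjExt adj X' Y p (f.comp x h) = (f.mapExactFunctor F).comp (adjExt adj X Y n x) h := by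
  rw [adjExt_apply, adjExt_apply, Ext.mapExactFunctor_comp, Ext.comp_assoc_of_third_deg_zero]

lemma adjExt_bijective [EnoughProjectives C] [G.PreservesEpimorphisms] (X : C) (Y : D) (n : ℕ) :
    Function.Bijective (adjExt adj X Y n) := by
  induction n generalizing X with
  | zero =>
    have : ⇑(adjExt adj X Y 0) = Ext.homEquiv₀.symm ∘ (adj.homEquiv X Y).symm ∘ Ext.homEquiv₀ := by
      ext x
      obtain ⟨f, rfl⟩ := (Ext.mk₀_bijective _ _).2 x
      simp [adjExt_apply, Ext.mapExactFunctor_mk₀, Ext.homEquiv₀, Adjunction.homEquiv_counit]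
    rw [this]
    exact (Equiv.bijective _).comp ((Equiv.bijective _).comp (Equiv.bijective _))
  | succ n hn =>
    let P : ProjectivePresentation X := Classical.arbitrary _
    let S := ShortComplex.mk _ _ (kernel.condition P.f)
    have : Projective (S.map F).X₂ := adj.map_projective _ P.projective
    have hX (m : ℕ) : Subsingleton (Ext S.X₂ (G.obj Y) (m + 1)) :=
      Ext.subsingleton_of_projective _ _ m
    have hFX (m : ℕ) : Subsingleton (Ext (S.map F).X₂ Y (m + 1)) :=
      Ext.subsingleton_of_projective _ _ m
    have hS : S.ShortExact := { exact := ShortComplex.exact_kernel P.f }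
    exact AddMonoidHom.bijective_of_surjective_of_bijective_of_right_exact _ _ _ _
      (adjExt adj S.X₂ Y n) (adjExt adj S.X₁ Y n) (adjExt adj S.X₃ Y (n + 1))
      (by ext x; simp [adjExt_comp, Ext.mapExactFunctor_mk₀]; rfl)
      (by ext x; simp [adjExt_comp, Ext.mapExactFunctor_extClass]; rfl)
      ((ShortComplex.ab_exact_iff_function_exact _).1
        (Ext.contravariant_sequence_exact₁' hS (G.obj Y) n (n + 1) (add_comm 1 n)))
      ((ShortComplex.ab_exact_iff_function_exact _).1
        (Ext.contravariant_sequence_exact₁' (hS.map F) Y n (n + 1) (add_comm 1 n)))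
      (hn _).surjective (hn _)
      (fun x₃ ↦ Ext.contravariant_sequence_exact₃ hS _ x₃ (by subsingleton) (add_comm 1 n))
      (fun y₃ ↦ Ext.contravariant_sequence_exact₃ (hS.map F) _ y₃ (by subsingleton) (add_comm 1 n))

end

section

open CategoryTheory Limits Opposite Abelian

variable {R : Type} [CommRing R]

lemma quot_hom_ext {I : Ideal R} {X : ModuleCat.{0} R} {f g : ModuleCat.of R (R ⧸ I) ⟶ X}
    (h : f (Ideal.Quotient.mk I 1) = g (Ideal.Quotient.mk I 1)) : f = g := by
  ext
  exact h

/-- The map `R ⧸ I → X` sending `1` to `x`. -/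
noncomputable def quotLift {I : Ideal R} {X : ModuleCat.{0} R} (x : X) (h : ∀ r ∈ I, r • x = 0) :
    ModuleCat.of R (R ⧸ I) ⟶ X :=
  ModuleCat.ofHom (Submodule.liftQ I (LinearMap.toSpanSingleton R X x) h)

lemma quotLift_one {I : Ideal R} {X : ModuleCat.{0} R} (x : X) (h : ∀ r ∈ I, r • x = 0) :
    quotLift x h (Ideal.Quotient.mk I 1) = x :=
  one_smul R x

variable (φ : R →+* R)

lemma extendScalars_quot_hom_ext {I : Ideal R} {X : ModuleCat.{0} R}
    {f g : (ModuleCat.extendScalars φ).obj (ModuleCat.of R (R ⧸ I)) ⟶ X}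
    (h : (((ModuleCat.extendRestrictScalarsAdj φ).homEquiv _ _) f) (Ideal.Quotient.mk I 1)
      = (((ModuleCat.extendRestrictScalarsAdj φ).homEquiv _ _) g) (Ideal.Quotient.mk I 1)) :
    f = g :=
  ((ModuleCat.extendRestrictScalarsAdj φ).homEquiv _ _).injective (quot_hom_ext h)

/-- The map `R ⧸ I → φ_* (R ⧸ I')` induced by `φ`. -/
noncomputable def quotRestrict {I I' : Ideal R} (h : I.map φ ≤ I') :
    ModuleCat.of R (R ⧸ I) ⟶ (ModuleCat.restrictScalars φ).obj (ModuleCat.of R (R ⧸ I')) :=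
  ModuleCat.ofHom (Y := (ModuleCat.restrictScalars φ).obj (ModuleCat.of R (R ⧸ I')))
    { toFun := Ideal.quotientMap I' φ (Ideal.map_le_iff_le_comap.1 h)
      map_add' := map_add _
      map_smul' := fun r x => by
        obtain ⟨x, rfl⟩ := Ideal.Quotient.mk_surjective x
        exact map_mul (Ideal.quotientMap I' φ (Ideal.map_le_iff_le_comap.1 h))
          (Ideal.Quotient.mk I r) (Ideal.Quotient.mk I x) }

/-- The map `φ^* (R ⧸ I) → R ⧸ I'` induced by `φ`. -/
noncomputable def extendQuot {I I' : Ideal R} (h : I.map φ ≤ I') :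
    (ModuleCat.extendScalars φ).obj (ModuleCat.of R (R ⧸ I)) ⟶ ModuleCat.of R (R ⧸ I') :=
  ((ModuleCat.extendRestrictScalarsAdj φ).homEquiv _ _).symm (quotRestrict φ h)

/-- The element `1 ⊗ 1` of `φ^* (R ⧸ I)`. -/
noncomputable def extendQuotOne (I : Ideal R) :
    (ModuleCat.extendScalars φ).obj (ModuleCat.of R (R ⧸ I)) :=
  (ModuleCat.extendRestrictScalarsAdj φ).unit.app (ModuleCat.of R (R ⧸ I)) (Ideal.Quotient.mk I 1)

/-- The map `R ⧸ I' → φ^* (R ⧸ I)` sending `1` to `1 ⊗ 1`. -/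
noncomputable def quotExtend {I I' : Ideal R} (h : I' ≤ I.map φ) :
    ModuleCat.of R (R ⧸ I') ⟶ (ModuleCat.extendScalars φ).obj (ModuleCat.of R (R ⧸ I)) :=
  quotLift (extendQuotOne φ I) (fun r hr => by
    rw [← LinearMap.toSpanSingleton_apply (R := R), ← LinearMap.mem_ker]
    refine h.trans (Ideal.map_le_iff_le_comap.2 fun r hr => ?_) hr
    have h1 := ((ModuleCat.extendRestrictScalarsAdj φ).unit.app
      (ModuleCat.of R (R ⧸ I))).hom.map_smul r (Ideal.Quotient.mk I 1)
    have h2 : r • (Ideal.Quotient.mk I 1) = 0 := by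
      rw [← Ideal.Quotient.mk_eq_mk, ← Submodule.Quotient.mk_smul]
      simpa [Ideal.Quotient.eq_zero_iff_mem] using hr
    exact h1.symm.trans ((congr_arg _ h2).trans (map_zero _)))

lemma quotExtend_one {I I' : Ideal R} (h : I' ≤ I.map φ) :
    quotExtend φ h (Ideal.Quotient.mk I' 1) = ((ModuleCat.extendRestrictScalarsAdj φ).unit.app
      (ModuleCat.of R (R ⧸ I)) (Ideal.Quotient.mk I 1)) :=
  quotLift_one _ _

lemma quotRestrict_one {I I' : Ideal R} (h : I.map φ ≤ I') :
    quotRestrict φ h (Ideal.Quotient.mk I 1) = Ideal.Quotient.mk I' 1 :=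
  map_one (Ideal.quotientMap I' φ (Ideal.map_le_iff_le_comap.1 h))

lemma homEquiv_extend_apply {M N : ModuleCat.{0} R}
    (f : (ModuleCat.extendScalars φ).obj M ⟶ N) (x : M) :
    f ((ModuleCat.extendRestrictScalarsAdj φ).unit.app M x) =
    (((ModuleCat.extendRestrictScalarsAdj φ).homEquiv _ _) f) x := by
  rw [Adjunction.homEquiv_unit]
  rfl

lemma quotExtend_comp_map_comp_extendQuot {I₁ I₂ I₃ I₄ : Ideal R} (h₁ : I₁ ≤ I₂.map φ)
    (h₂ : I₂ ≤ I₃) (h₃ : I₃.map φ ≤ I₄) (h₄ : I₁ ≤ I₄) :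
    quotExtend φ h₁ ≫ (ModuleCat.extendScalars φ).map (quotProj h₂) ≫ extendQuot φ h₃ =
      quotProj h₄ := by
  apply quot_hom_ext
  rw [ModuleCat.comp_apply, quotExtend_one, homEquiv_extend_apply,
    Adjunction.homEquiv_naturality_left, extendQuot, Equiv.apply_symm_apply, ModuleCat.comp_apply]
  exact quotRestrict_one φ h₃

lemma extendQuot_comp_quotProj_comp_quotExtend {I₁ I₂ I₃ I₄ : Ideal R} (h₁ : I₁.map φ ≤ I₂)
    (h₂ : I₂ ≤ I₃) (h₃ : I₃ ≤ I₄.map φ) (h₄ : I₁ ≤ I₄) :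
    extendQuot φ h₁ ≫ quotProj h₂ ≫ quotExtend φ h₃ =
      (ModuleCat.extendScalars φ).map (quotProj h₄) := by
  apply extendScalars_quot_hom_ext
  rw [Adjunction.homEquiv_naturality_right, extendQuot, Equiv.apply_symm_apply,
    Adjunction.homEquiv_unit, ModuleCat.comp_apply, quotRestrict_one]
  have h := ConcreteCategory.congr_hom
    ((ModuleCat.extendRestrictScalarsAdj φ).unit.naturality (quotProj h₄)) (Ideal.Quotient.mk I₁ 1)
  exact (quotExtend_one φ h₃).trans h

lemma extVanishes_restrictScalars_iff (hφ : φ.Flat) (J : Ideal R) (h₁ : J.map φ ≤ J)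
    (h₂ : ∀ t, ∃ s, J ^ s ≤ (J ^ t).map φ) (i : ℕ) (M : ModuleCat.{0} R) :
    ExtVanishes J i ((ModuleCat.restrictScalars φ).obj M) ↔ ExtVanishes J i M := by
  have := ModuleCat.preservesFiniteLimits_extendScalars_of_flat hφ
  have h₁' (t) : (J ^ t).map φ ≤ J ^ t := by
    rw [Ideal.map_pow]
    exact Ideal.pow_right_mono h₁ t
  have h₂' (t t₀) : ∃ s ≥ t₀, J ^ s ≤ (J ^ t).map φ := by
    obtain ⟨s, hs⟩ := h₂ t
    exact ⟨max s t₀, le_max_right _ _, (Ideal.pow_le_pow_right (le_max_left _ _)).trans hs⟩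
  have : (ModuleCat.extendScalars φ).Additive :=
    (ModuleCat.extendRestrictScalarsAdj φ).left_adjoint_additive
  have : PreservesFiniteColimits (ModuleCat.extendScalars φ) :=
    have := (ModuleCat.extendRestrictScalarsAdj φ).leftAdjoint_preservesColimits
    inferInstance
  let β (t) := adjExt (ModuleCat.extendRestrictScalarsAdj φ) (ModuleCat.of R (R ⧸ J ^ t)) M i
  have hβ (t) : Function.Bijective (β t) := adjExt_bijective _ _ _ _
  have hβp (s t) (h : t ≤ s) (y) :
      β s ((Ext.mk₀ (quotProj (Ideal.pow_le_pow_right (I := J) h))).comp y (zero_add i)) =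
      (Ext.mk₀ ((ModuleCat.extendScalars φ).map
        (quotProj (Ideal.pow_le_pow_right (I := J) h)))).comp (β t y) (zero_add i) := by
    rw [adjExt_comp, Ext.mapExactFunctor_mk₀]
  constructor
  · intro H t x
    obtain ⟨y, hy⟩ := (hβ t).2 ((Ext.mk₀ (extendQuot φ (h₁' t))).comp x (zero_add i))
    obtain ⟨s, hs, hs0⟩ := H t y
    obtain ⟨s', hs', hle⟩ := h₂' s s
    refine ⟨s', hs.trans hs', ?_⟩
    have h := hβp s t hs y
    rw [hs0, map_zero, hy, Ext.mk₀_comp_mk₀_assoc] at h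
    rw [← quotExtend_comp_map_comp_extendQuot φ hle (Ideal.pow_le_pow_right hs) (h₁' t),
      ← Ext.mk₀_comp_mk₀_assoc, ← h, Ext.comp_zero]
  · intro H t y
    obtain ⟨s', hs', hle⟩ := h₂' t t
    obtain ⟨s, hs, hs0⟩ := H s' ((Ext.mk₀ (quotExtend φ hle)).comp (β t y) (zero_add i))
    refine ⟨s, hs'.trans hs, (hβ s).1 ?_⟩
    rw [map_zero, hβp, ← extendQuot_comp_quotProj_comp_quotExtend φ (h₁' s)
      (Ideal.pow_le_pow_right hs) hle, ← Ext.mk₀_comp_mk₀_assoc, ← Ext.mk₀_comp_mk₀_assoc, hs0,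
      Ext.comp_zero]
    exact hs'.trans hs

lemma ExtVanishes.of_sum {J : Ideal R} {i : ℕ} {M M' : ModuleCat.{0} R} (h : ExtVanishes J i M)
    {ι : Type*} (T : Finset ι) (f : ι → (M' ⟶ M)) (g : ι → (M ⟶ M'))
    (hfg : ∑ j ∈ T, f j ≫ g j = 𝟙 M') : ExtVanishes J i M' := by
  intro t x
  have hpull (j : ι) : ∃ s : ℕ, ∀ s' ≥ s, ∀ h : t ≤ s',
      (Ext.mk₀ (quotProj (Ideal.pow_le_pow_right (I := J) h))).comp
      (x.comp (Ext.mk₀ (f j)) (add_zero i)) (zero_add i) = 0 := by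
    obtain ⟨s, hs, h0⟩ := h t (x.comp (Ext.mk₀ (f j)) (add_zero i))
    refine ⟨s, fun s' hs' h' => ?_⟩
    have : quotProj (Ideal.pow_le_pow_right (I := J) h') =
      quotProj (Ideal.pow_le_pow_right hs') ≫ quotProj (Ideal.pow_le_pow_right (I := J) hs) :=
        quot_hom_ext rfl
    rw [this, ← Ext.mk₀_comp_mk₀_assoc, h0, Ext.comp_zero]
  choose s hs using hpull
  refine ⟨max t (T.sup s), le_max_left _ _, ?_⟩
  set p := Ext.mk₀ (quotProj (Ideal.pow_le_pow_right (I := J) (le_max_left t (T.sup s))))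
  have : x = ∑ j ∈ T, (x.comp (Ext.mk₀ (f j)) (add_zero i)).comp (Ext.mk₀ (g j)) (add_zero i) := by
    simp only [Ext.comp_assoc_of_third_deg_zero, Ext.mk₀_comp_mk₀]
    have := map_sum ((x.precomp M' (add_zero i)).comp Ext.addEquiv₀.symm.toAddMonoidHom)
      (fun j => f j ≫ g j) T
    rw [hfg] at this
    exact (Ext.comp_mk₀_id x).symm.trans this
  rw [this]
  refine (map_sum (p.precomp M' (zero_add i)) _ T).trans ?_
  refine Finset.sum_eq_zero fun j hj => ?_
  change p.comp (Ext.comp (x.comp (Ext.mk₀ (f j)) (add_zero i)) (Ext.mk₀ (g j)) (add_zero i))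
    (zero_add i) = 0
  rw [← Ext.comp_assoc_of_third_deg_zero, hs j _ ((Finset.le_sup hj).trans (le_max_right _ _)),
    Ext.zero_comp]
  exact le_max_left _ _

end

section

variable {k σ : Type} [Field k] {N : ℕ}

lemma map_expand_maxHomIdeal_le [NeZero N] :
    (maxHomIdeal k σ).map ((expand N : MvPolynomial σ k →ₐ[k] MvPolynomial σ k) :
      MvPolynomial σ k →+* MvPolynomial σ k) ≤ maxHomIdeal k σ := by
  rw [maxHomIdeal, Ideal.map_span, Ideal.span_le]
  rintro _ ⟨_, ⟨j, rfl⟩, rfl⟩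
  simp only [RingHom.coe_coe, expand_X]
  exact Ideal.pow_mem_of_mem _ (Ideal.subset_span (Set.mem_range_self j)) _
    (Nat.pos_of_ne_zero (NeZero.ne N))

lemma exists_pow_le_map_expand [Finite σ] (t : ℕ) :
    ∃ s, maxHomIdeal k σ ^ s ≤ (maxHomIdeal k σ ^ t).map
      ((expand N : MvPolynomial σ k →ₐ[k] MvPolynomial σ k) :
        MvPolynomial σ k →+* MvPolynomial σ k) := by
  refine Ideal.exists_pow_le_of_le_radical_of_fg ?_
    ((isNoetherianRing_iff_ideal_fg _).1 inferInstance _)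
  rw [maxHomIdeal, Ideal.span_le]
  rintro _ ⟨j, rfl⟩
  refine ⟨N * t, ?_⟩
  rw [pow_mul, ← expand_X, ← map_pow]
  exact Ideal.mem_map_of_mem _ (Ideal.pow_mem_pow (Ideal.subset_span (Set.mem_range_self j)) t)

end

section

variable {R : Type} [CommRing R]

/-- The map `R ⧸ I → R ⧸ I'` induced by an additive map `f` on `R` that is linear over `φ`. -/
noncomputable def quotSemilinearMap (φ : R →+* R) {I I' : Ideal R} (f : R →+ R)
    (hf : ∀ a x, f (φ a * x) = φ a * f x) (hI : ∀ x ∈ I, f x ∈ I') :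
    (ModuleCat.restrictScalars φ).obj (ModuleCat.of R (R ⧸ I)) ⟶
      (ModuleCat.restrictScalars φ).obj (ModuleCat.of R (R ⧸ I')) :=
  let F := QuotientAddGroup.map I.toAddSubgroup I'.toAddSubgroup f hI
  ModuleCat.ofHom
    (X := (ModuleCat.restrictScalars φ).obj (ModuleCat.of R (R ⧸ I)))
    (Y := (ModuleCat.restrictScalars φ).obj (ModuleCat.of R (R ⧸ I')))
    { toFun := F
      map_add' := map_add F
      map_smul' := fun a x => by
        obtain ⟨x, rfl⟩ := Ideal.Quotient.mk_surjective x
        exact congrArg (Ideal.Quotient.mk I') (hf a x) }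

lemma ExtVanishes.of_semilinear_retract {J I I' : Ideal R} {i : ℕ}
    (h : ExtVanishes J i (ModuleCat.of R (R ⧸ I))) (φ : R →+* R) (hφ : φ.Flat)
    (h₁ : J.map φ ≤ J) (h₂ : ∀ t, ∃ s, J ^ s ≤ (J ^ t).map φ) {ι : Type*} (T : Finset ι)
    (f g : ι → R →+ R) (hf : ∀ j a x, f j (φ a * x) = φ a * f j x)
    (hg : ∀ j a x, g j (φ a * x) = φ a * g j x) (hfI : ∀ j, ∀ x ∈ I', f j x ∈ I)
    (hgI : ∀ j, ∀ x ∈ I, g j x ∈ I') (hfg : ∀ x, ∑ j ∈ T, g j (f j x) = x) :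
    ExtVanishes J i (ModuleCat.of R (R ⧸ I')) := by
  rw [← extVanishes_restrictScalars_iff φ hφ J h₁ h₂] at h ⊢
  refine h.of_sum T (fun j => quotSemilinearMap φ (f j) (hf j) (hfI j))
    (fun j => quotSemilinearMap φ (g j) (hg j) (hgI j)) ?_
  ext x
  obtain ⟨x, rfl⟩ := Ideal.Quotient.mk_surjective x
  rw [ModuleCat.hom_sum]
  refine (LinearMap.sum_apply _ _ _).trans ?_
  refine Eq.trans ?_ (congrArg (Ideal.Quotient.mk I') (hfg x))
  exact (map_sum (Ideal.Quotient.mk I') _ _).symm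

variable {k σ : Type} [Field k] [Fintype σ] {N : ℕ}

/-- The exponent vector of a point of the box `{0, …, N - 1} ^ σ`. -/
noncomputable def boxExponent (r : σ → Fin N) : σ →₀ ℕ :=
  Finsupp.equivFunOnFinite.symm fun j => (r j : ℕ)

@[simp] lemma boxExponent_apply (r : σ → Fin N) (j : σ) : boxExponent r j = r j := rfl

/-- The `k`-linear map on polynomials extracting the coefficients at the exponents in the class of
`r` modulo `N`. -/
noncomputable def boxCoeff (r : σ → Fin N) : MvPolynomial σ k →ₗ[k] MvPolynomial σ k :=
  (basisMonomials σ k).constr k fun c =>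
    open Classical in if h : ∃ q, c = N • q + boxExponent r then monomial h.choose 1 else 0

/-- The endomorphism of `k[σ]` over the substitution `X j ↦ X j ^ N` that moves the class of
exponents `r` modulo `N` onto the class of `r'` and kills the others. -/
noncomputable def boxShift (r r' : σ → Fin N) : MvPolynomial σ k →ₗ[k] MvPolynomial σ k :=
  (LinearMap.mulLeft k (monomial (boxExponent r') 1)).comp
    ((expand N : MvPolynomial σ k →ₐ[k] MvPolynomial σ k).toLinearMap.comp (boxCoeff r))

lemma boxShift_apply (r r' : σ → Fin N) (h : MvPolynomial σ k) :
    boxShift r r' h = monomial (boxExponent r') 1 * expand N (boxCoeff r h) := rfl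

variable [NeZero N]

lemma smul_add_boxExponent_inj {q q' : σ →₀ ℕ} {r r' : σ → Fin N} :
    N • q + boxExponent r = N • q' + boxExponent r' ↔ q = q' ∧ r = r' := by
  refine ⟨fun h => ?_, fun ⟨h, h'⟩ => h ▸ h' ▸ rfl⟩
  have hN : 0 < N := Nat.pos_of_ne_zero (NeZero.ne N)
  have h' (j : σ) : N * q j + r j = N * q' j + r' j := by
    simpa using DFunLike.congr_fun h j
  constructor
  · ext j
    have := congrArg (· / N) (h' j)
    simpa [Nat.mul_add_div hN, Nat.div_eq_of_lt] using this
  · ext j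
    have := congrArg (· % N) (h' j)
    simpa [Nat.mul_add_mod, Nat.mod_eq_of_lt] using this

lemma exists_smul_add_boxExponent (c : σ →₀ ℕ) :
    ∃ (q : σ →₀ ℕ) (r : σ → Fin N), c = N • q + boxExponent r := by
  refine ⟨c.mapRange (· / N) (Nat.zero_div N), fun j => Fin.ofNat N (c j), ?_⟩
  ext j
  simp [Nat.div_add_mod]

lemma boxCoeff_monomial (r r' : σ → Fin N) (q : σ →₀ ℕ) (a : k) :
    boxCoeff r (monomial (N • q + boxExponent r') a) = if r' = r then monomial q a else 0 := by
  have : monomial (N • q + boxExponent r') a = a • monomial (N • q + boxExponent r') (1 : k) := by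
    simp [smul_monomial]
  rw [this, map_smul, show monomial (N • q + boxExponent r') (1 : k) =
    basisMonomials σ k (N • q + boxExponent r') by simp, boxCoeff, Module.Basis.constr_basis]
  split_ifs with h h' h'
  · rw [(smul_add_boxExponent_inj.1 h.choose_spec).1.symm]; simp [smul_monomial]
  · exact absurd (smul_add_boxExponent_inj.1 h.choose_spec).2 h'
  · exact absurd ⟨q, h' ▸ rfl⟩ h
  · simp

lemma boxCoeff_expand_mul (r : σ → Fin N) (g h : MvPolynomial σ k) :
    boxCoeff r (expand N g * h) = g * boxCoeff r h := by
  induction h using MvPolynomial.induction_on' with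
  | add p q hp hq => simp only [mul_add, map_add, hp, hq]
  | monomial c a =>
    induction g using MvPolynomial.induction_on' with
    | add p q hp hq => simp only [add_mul, map_add, hp, hq]
    | monomial d b =>
      obtain ⟨q, r', rfl⟩ := exists_smul_add_boxExponent (N := N) c
      rw [expand_monomial, monomial_mul, ← add_assoc, ← smul_add, boxCoeff_monomial,
        boxCoeff_monomial]
      split_ifs <;> simp

lemma boxCoeff_monomial_mul_expand (r r' : σ → Fin N)
    (g : MvPolynomial σ k) :
    boxCoeff r (monomial (boxExponent r') 1 * expand N g) = if r' = r then g else 0 := by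
  have := boxCoeff_monomial (k := k) r r' 0 1
  rw [smul_zero, zero_add] at this
  rw [mul_comm, boxCoeff_expand_mul, this]
  split_ifs <;> simp

lemma sum_boxCoeff [DecidableEq σ] (h : MvPolynomial σ k) :
    ∑ r : σ → Fin N, monomial (boxExponent r) 1 * expand N (boxCoeff r h) = h := by
  induction h using MvPolynomial.induction_on' with
  | add p q hp hq => simp only [map_add, mul_add, Finset.sum_add_distrib, hp, hq]
  | monomial c a =>
    obtain ⟨q, r', rfl⟩ := exists_smul_add_boxExponent (N := N) c
    rw [Finset.sum_eq_single r']
    · rw [boxCoeff_monomial, if_pos rfl, expand_monomial, monomial_mul, one_mul, add_comm]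
    · intro r _ hr
      simp [boxCoeff_monomial, hr.symm]
    · simp

lemma boxShift_expand_mul (r r' : σ → Fin N) (g h : MvPolynomial σ k) :
    boxShift r r' (expand N g * h) = expand N g * boxShift r r' h := by
  simp only [boxShift_apply, boxCoeff_expand_mul, map_mul, mul_left_comm]

lemma boxShift_boxShift (r r' : σ → Fin N) (h : MvPolynomial σ k) :
    boxShift r' r (boxShift r r' h) = boxShift r r h := by
  simp only [boxShift_apply, boxCoeff_monomial_mul_expand, if_true]

lemma sum_boxShift [DecidableEq σ] (h : MvPolynomial σ k) : ∑ r : σ → Fin N, boxShift r r h = h :=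
  sum_boxCoeff h

lemma boxShift_mem {A A' : Set (σ →₀ ℕ)} {r r' : σ → Fin N}
    (H : ∀ q : σ →₀ ℕ, (∃ s ∈ A, s ≤ N • q + boxExponent r) →
      ∃ s ∈ A', s ≤ N • q + boxExponent r') {h : MvPolynomial σ k}
    (hh : h ∈ Ideal.span ((fun s => monomial s (1 : k)) '' A)) :
    boxShift r r' h ∈ Ideal.span ((fun s => monomial s (1 : k)) '' A') := by
  rw [mem_ideal_span_monomial_image] at hh
  rw [h.as_sum, map_sum]
  refine Ideal.sum_mem _ fun c hc => ?_
  have := hh c hc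
  obtain ⟨q, r'', rfl⟩ := exists_smul_add_boxExponent (N := N) c
  rw [boxShift_apply, boxCoeff_monomial]
  split_ifs with hr
  · subst hr
    rw [expand_monomial, monomial_mul, add_comm, mem_ideal_span_monomial_image]
    intro c hc
    rw [Finset.mem_singleton.1 (support_monomial_subset hc)]
    exact H q this
  · simp

lemma RingHom.Flat.of_sum_mul_eq {A B ι : Type} [CommRing A] [CommRing B] [Fintype ι]
    (φ : A →+* B) (b : ι → B) (U : ι → B →+ A) (hU : ∀ i a x, U i (φ a * x) = a * U i x)
    (h : ∀ x, ∑ i, b i * φ (U i x) = x) : φ.Flat := by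
  let _ := φ.toAlgebra
  change Module.Flat A B
  refine Module.Flat.of_retract (M := ι → A)
    (LinearMap.pi fun i => { toFun := U i, map_add' := map_add _, map_smul' := fun a x => ?_ })
    (Fintype.linearCombination A b) ?_
  · exact (congrArg (U i) (Algebra.smul_def a x)).trans (hU i a x)
  · ext x
    refine Eq.trans ?_ (h x)
    simp [Fintype.linearCombination_apply, Algebra.smul_def, RingHom.algebraMap_toAlgebra, mul_comm]

lemma expand_flat [DecidableEq σ] : ((expand N : MvPolynomial σ k →ₐ[k] MvPolynomial σ k) :
    MvPolynomial σ k →+* MvPolynomial σ k).Flat :=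
  .of_sum_mul_eq _ (fun r : σ → Fin N => monomial (boxExponent r) 1)
    (fun r => (boxCoeff r).toAddMonoidHom) boxCoeff_expand_mul sum_boxCoeff

lemma extVanishes_monomial_quotient [DecidableEq σ] {A A' : Set (σ →₀ ℕ)} (N : ℕ) [NeZero N]
    (H : ∀ r : σ → Fin N, ∃ r' : σ → Fin N, ∀ q : σ →₀ ℕ,
      (∃ s ∈ A', s ≤ N • q + boxExponent r) ↔ ∃ s ∈ A, s ≤ N • q + boxExponent r') {i : ℕ}
    (hA : ExtVanishes (maxHomIdeal k σ) i (ModuleCat.of (MvPolynomial σ k)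
      (MvPolynomial σ k ⧸ Ideal.span ((fun s => monomial s (1 : k)) '' A)))) :
    ExtVanishes (maxHomIdeal k σ) i (ModuleCat.of (MvPolynomial σ k)
      (MvPolynomial σ k ⧸ Ideal.span ((fun s => monomial s (1 : k)) '' A'))) := by
  choose ρ hρ using H
  exact hA.of_semilinear_retract _ expand_flat map_expand_maxHomIdeal_le exists_pow_le_map_expand
    Finset.univ (fun r => (boxShift r (ρ r)).toAddMonoidHom)
    (fun r => (boxShift (ρ r) r).toAddMonoidHom)
    (fun r a x => boxShift_expand_mul r (ρ r) a x) (fun r a x => boxShift_expand_mul (ρ r) r a x)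
    (fun r _ => boxShift_mem fun q => (hρ r q).1) (fun r _ => boxShift_mem fun q => (hρ r q).2)
    fun x => (Finset.sum_congr rfl fun r _ => boxShift_boxShift r (ρ r) x).trans (sum_boxShift x)

end

section

variable {V : Type} (G : SimpleGraph V)

/-- The exponents of the generators of the `t`-th power of the edge ideal of `G`, that is, of
products of `t` edges. -/
def edgeSums : ℕ → Set (V →₀ ℕ)
  | 0 => {0}
  | t + 1 => {c | ∃ s ∈ edgeSums t, ∃ i j, G.Adj i j ∧
      c = s + (Finsupp.single i 1 + Finsupp.single j 1)}

lemma edgeIdeal_pow (k : Type) [Field k] (t : ℕ) :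
    edgeIdeal k G ^ t = Ideal.span ((fun s => monomial s (1 : k)) '' edgeSums G t) := by
  induction t with
  | zero => simp [edgeSums, Ideal.one_eq_top]
  | succ t ih =>
    rw [pow_succ, ih, edgeIdeal, Ideal.span_mul_span']
    congr 1
    ext p
    simp only [Set.mem_mul, Set.mem_image, edgeSums, Set.mem_ofPred_eq]
    constructor
    · rintro ⟨_, ⟨s, hs, rfl⟩, _, ⟨i, j, hij, rfl⟩, rfl⟩
      exact ⟨_, ⟨s, hs, i, j, hij, rfl⟩, by simp [X, monomial_mul]⟩
    · rintro ⟨_, ⟨s, hs, i, j, hij, rfl⟩, rfl⟩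
      exact ⟨_, ⟨s, hs, rfl⟩, _, ⟨i, j, hij, rfl⟩, by simp [X, monomial_mul]⟩

variable {G}

lemma apply_le_of_mem_edgeSums {t : ℕ} {s : V →₀ ℕ} (hs : s ∈ edgeSums G t) (x : V) : s x ≤ t := by
  classical
  induction t generalizing s with
  | zero => simp_all [edgeSums]
  | succ t ih =>
    obtain ⟨s, hs', i, j, hij, rfl⟩ := hs
    have := ih hs'
    have := hij.ne
    simp only [Finsupp.add_apply, Finsupp.single_apply]
    split_ifs <;> lia

lemma mem_edgeSums_succ_of_leaf {u v : V} (hu : G.neighborSet u = {v}) {t : ℕ} {s : V →₀ ℕ}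
    (hs : s ∈ edgeSums G (t + 1)) :
    (∃ s' ∈ edgeSums G t, s = s' + (Finsupp.single u 1 + Finsupp.single v 1)) ∨
    (s u = 0 ∧ ∃ s' ∈ edgeSums G t, s' ≤ s ∧ (1 ≤ s v → s' v + 1 ≤ s v)) := by
  classical
  have hadj (w : V) : G.Adj u w ↔ w = v := by
    rw [← SimpleGraph.mem_neighborSet, hu, Set.mem_singleton_iff]
  have hedge {i j : V} (hij : G.Adj i j) :
      (Finsupp.single i 1 + Finsupp.single j 1 : V →₀ ℕ) =
        Finsupp.single u 1 + Finsupp.single v 1 ∨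
      (Finsupp.single i 1 + Finsupp.single j 1 : V →₀ ℕ) u = 0 := by
    by_cases hi : i = u
    · subst hi; rw [(hadj j).1 hij]; exact .inl rfl
    by_cases hj : j = u
    · subst hj; rw [(hadj i).1 hij.symm, add_comm]; exact .inl rfl
    exact .inr (by simp [hi, hj])
  induction t generalizing s with
  | zero =>
    obtain ⟨s₁, hs₁, i, j, hij, rfl⟩ := hs
    rcases hedge hij with h | h
    · exact .inl ⟨s₁, hs₁, by rw [h]⟩
    · obtain rfl : s₁ = 0 := hs₁
      exact .inr ⟨by rwa [zero_add], 0, rfl, zero_le, by simp⟩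
  | succ t ih =>
    obtain ⟨s₁, hs₁, i, j, hij, rfl⟩ := hs
    rcases hedge hij with h | h
    · exact .inl ⟨s₁, hs₁, by rw [h]⟩
    rcases ih hs₁ with ⟨s', hs', rfl⟩ | ⟨h0, s', hs', hle, hv⟩
    · exact .inl ⟨s' + (Finsupp.single i 1 + Finsupp.single j 1), ⟨s', hs', i, j, hij, rfl⟩,
        add_right_comm _ _ _⟩
    · refine .inr ⟨by rw [Finsupp.add_apply, h0, h], ?_⟩
      by_cases h1 : 1 ≤ s₁ v
      · refine ⟨s' + (Finsupp.single i 1 + Finsupp.single j 1), ⟨s', hs', i, j, hij, rfl⟩,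
          by gcongr, fun _ => ?_⟩
        have := hv h1
        simp only [Finsupp.add_apply] at *
        lia
      · refine ⟨s₁, hs₁, le_self_add, fun h => ?_⟩
        simp only [Finsupp.add_apply] at *
        lia

lemma exists_mem_edgeSums_succ_iff {u v : V} (huv : G.Adj u v) (hu : G.neighborSet u = {v})
    (t : ℕ) (c : V →₀ ℕ) :
    (∃ s ∈ edgeSums G (t + 1), s ≤ c + (Finsupp.single u 1 + Finsupp.single v 1)) ↔
      ∃ s ∈ edgeSums G t, s ≤ c := by
  classical
  constructor
  · rintro ⟨s, hs, hle⟩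
    rcases mem_edgeSums_succ_of_leaf hu hs with ⟨s', hs', rfl⟩ | ⟨h0, s', hs', hle', hv⟩
    · exact ⟨s', hs', le_of_add_le_add_right hle⟩
    · refine ⟨s', hs', fun x => ?_⟩
      have h1 := hle x
      have h2 := hle' x
      simp only [Finsupp.add_apply, Finsupp.single_apply] at h1
      by_cases hxu : x = u
      · subst hxu; lia
      by_cases hxv : x = v
      · subst hxv
        simp only [Ne.symm hxu, if_false, if_true] at h1
        by_cases h : 1 ≤ s x
        · have := hv h; lia
        · lia
      · simp only [Ne.symm hxu, Ne.symm hxv, if_false] at h1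
        lia
  · rintro ⟨s, hs, hle⟩
    exact ⟨_, ⟨s, hs, u, v, huv, rfl⟩, by gcongr⟩

lemma exists_boxExponent_edgeSums_iff [Fintype V] {u v : V} (huv : G.Adj u v)
    (hu : G.neighborSet u = {v}) (t : ℕ) (r : V → Fin (t + 2)) :
    ∃ r' : V → Fin (t + 2), ∀ q : V →₀ ℕ,
      (∃ s ∈ edgeSums G t, s ≤ (t + 2) • q + boxExponent r) ↔
        ∃ s ∈ edgeSums G (t + 1), s ≤ (t + 2) • q + boxExponent r' := by
  let e : V →₀ ℕ := Finsupp.single u 1 + Finsupp.single v 1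
  refine ⟨fun x => ⟨min (r x + e x) (t + 1), by lia⟩, fun q => ?_⟩
  rw [← exists_mem_edgeSums_succ_iff huv hu]
  refine exists_congr fun s => and_congr_right fun hs => ?_
  refine forall_congr' fun x => ?_
  have h1 := apply_le_of_mem_edgeSums hs x
  change s x ≤ (t + 2) * q x + r x + e x ↔ s x ≤ (t + 2) * q x + min (r x + e x) (t + 1)
  generalize (t + 2) * q x = a
  lia

lemma ExtVanishes.edgeIdeal_pow [Fintype V] [DecidableEq V] {k : Type} [Field k] {u v : V}
    (huv : G.Adj u v) (hu : G.neighborSet u = {v}) {t i : ℕ}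
    (h : ExtVanishes (maxHomIdeal k V) i
      (ModuleCat.of _ (MvPolynomial V k ⧸ edgeIdeal k G ^ (t + 1)))) :
    ExtVanishes (maxHomIdeal k V) i (ModuleCat.of _ (MvPolynomial V k ⧸ edgeIdeal k G ^ t)) := by
  rw [_root_.edgeIdeal_pow] at h ⊢
  exact extVanishes_monomial_quotient (t + 2) (exists_boxExponent_edgeSums_iff huv hu t) h

end

section

open CategoryTheory Limits Abelian

variable {R : Type} [CommRing R]

lemma ExtVanishes.of_shortExact {J : Ideal R} {i : ℕ} {S : ShortComplex (ModuleCat.{0} R)}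
    (hS : S.ShortExact) (h₁ : ExtVanishes J (i + 1) S.X₁) (h₂ : ExtVanishes J i S.X₂) :
    ExtVanishes J i S.X₃ := by
  intro t x
  obtain ⟨s, hts, hs⟩ := h₁ t (x.comp hS.extClass rfl)
  rw [← Ext.comp_assoc _ _ _ (zero_add i) rfl (by lia)] at hs
  obtain ⟨y, hy⟩ := Ext.covariant_sequence_exact₃ _ hS _ rfl hs
  obtain ⟨s', hs', h0⟩ := h₂ s y
  refine ⟨s', hts.trans hs', ?_⟩
  have : quotProj (Ideal.pow_le_pow_right (I := J) (hts.trans hs')) =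
      quotProj (Ideal.pow_le_pow_right hs') ≫ quotProj (Ideal.pow_le_pow_right (I := J) hts) :=
    quot_hom_ext rfl
  rw [this, ← Ext.mk₀_comp_mk₀_assoc, ← hy, ← Ext.comp_assoc_of_third_deg_zero, h0, Ext.zero_comp]

lemma ExtVanishes.quotient_sup_span {J Q : Ideal R} {a : R}
    (ha : IsSMulRegular (R ⧸ Q) a) (h : ∀ i, ExtVanishes J i (ModuleCat.of R (R ⧸ Q))) (i : ℕ) :
    ExtVanishes J i (ModuleCat.of R (R ⧸ Q ⊔ Ideal.span {a})) := by
  let f : ModuleCat.of R (R ⧸ Q) ⟶ ModuleCat.of R (R ⧸ Q) :=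
    ModuleCat.ofHom (LinearMap.lsmul R (R ⧸ Q) a)
  let g := quotProj (le_sup_left : Q ≤ Q ⊔ Ideal.span {a})
  have hfg : Function.Exact f g := by
    intro y
    obtain ⟨y, rfl⟩ := Ideal.Quotient.mk_surjective y
    change Ideal.Quotient.mk _ y = 0 ↔ _
    rw [Ideal.Quotient.eq_zero_iff_mem, Submodule.mem_sup]
    constructor
    · rintro ⟨q, hq, _, hr, rfl⟩
      obtain ⟨r, rfl⟩ := Ideal.mem_span_singleton'.1 hr
      refine ⟨Ideal.Quotient.mk _ r, ?_⟩
      change Ideal.Quotient.mk Q (a * r) = _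
      rw [map_add, Ideal.Quotient.eq_zero_iff_mem.2 hq, zero_add, mul_comm]
    · rintro ⟨r, hr⟩
      obtain ⟨r, rfl⟩ := Ideal.Quotient.mk_surjective r
      have hr : Ideal.Quotient.mk Q y = Ideal.Quotient.mk Q (a * r) := hr.symm
      exact ⟨y - a * r, Ideal.Quotient.eq.1 hr, a * r,
        Ideal.mul_mem_right _ _ (Ideal.mem_span_singleton_self a), sub_add_cancel _ _⟩
  have hw : f ≫ g = 0 := quot_hom_ext (hfg.apply_apply_eq_zero (Ideal.Quotient.mk Q 1))
  have hS : (ShortComplex.mk f g hw).ShortExact :=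
    { exact := ModuleCat.shortComplex_exact _ hfg
      mono_f := (ModuleCat.mono_iff_injective _).2 ha
      epi_g := (ModuleCat.epi_iff_surjective _).2 (Ideal.Quotient.factor_surjective le_sup_left) }
  exact .of_shortExact hS (h _) (h _)

lemma ExtVanishes.eq_zero {J : Ideal R} {M : ModuleCat.{0} R} (h : ExtVanishes J 0 M) {y : M}
    (hy : ∀ a ∈ J, a • y = 0) : y = 0 := by
  have hy' : ∀ a ∈ J ^ 1, a • y = 0 := fun a ha => hy a (by rwa [pow_one] at ha)
  obtain ⟨s, hs, h0⟩ := h 1 (Ext.mk₀ (quotLift y hy'))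
  rw [Ext.mk₀_comp_mk₀, Ext.mk₀_eq_zero_iff] at h0
  have : quotLift y hy' (Ideal.Quotient.mk _ 1) = 0 :=
    congrArg (fun f => f (Ideal.Quotient.mk (J ^ s) 1)) h0
  rwa [quotLift_one] at this

lemma exists_not_extVanishes [IsNoetherianRing R] {J I : Ideal R} (hI : I ≤ J) (hJ : J ≠ ⊤) :
    ∃ i, ¬ ExtVanishes J i (ModuleCat.of R (R ⧸ I)) := by
  by_contra! h
  obtain ⟨Q, ⟨hQJ, hQ⟩, hmax⟩ := set_has_maximal_iff_noetherian.2 ‹IsNoetherianRing R›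
    {Q : Ideal R | Q ≤ J ∧ ∀ i, ExtVanishes J i (ModuleCat.of R (R ⧸ Q))} ⟨I, hI, h⟩
  have hsub : Subsingleton ((R ⧸ J) →ₗ[R] R ⧸ Q) := by
    refine subsingleton_of_forall_eq 0 fun f => ?_
    have h1 : f 1 = 0 := (hQ 0).eq_zero fun a ha => by
      refine (map_smul f a 1).symm.trans ?_
      rw [Algebra.smul_def, mul_one, Ideal.Quotient.algebraMap_eq,
        Ideal.Quotient.eq_zero_iff_mem.2 ha, map_zero]
    ext
    exact h1
  obtain ⟨a, ha, hreg⟩ := IsSMulRegular.subsingleton_linearMap_iff.1 hsub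
  rw [Ideal.annihilator_quotient] at ha
  have hle : Q ⊔ Ideal.span {a} ≤ J := sup_le hQJ ((Ideal.span_singleton_le_iff_mem _).2 ha)
  have haQ : a ∈ Q := by
    by_contra haQ
    refine hmax _ ⟨hle, ExtVanishes.quotient_sup_span hreg hQ⟩
      (lt_of_le_of_ne le_sup_left fun h => haQ ?_)
    rw [h]
    exact Submodule.mem_sup_right (Ideal.mem_span_singleton_self a)
  have h1 : (1 : R ⧸ Q) = 0 := hreg <| by
    change a • (1 : R ⧸ Q) = a • 0
    rw [smul_zero, Algebra.smul_def, mul_one]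
    exact Ideal.Quotient.eq_zero_iff_mem.2 haQ
  exact hJ ((Ideal.eq_top_iff_one _).2 (hQJ (Ideal.Quotient.eq_zero_iff_mem.1 h1)))

end

section

variable {k V : Type} [Field k]

lemma maxHomIdeal_ne_top : maxHomIdeal k V ≠ ⊤ := by
  have : maxHomIdeal k V ≤ RingHom.ker (constantCoeff : MvPolynomial V k →+* k) := by
    rw [maxHomIdeal, Ideal.span_le]
    rintro _ ⟨j, rfl⟩
    simp
  exact fun h => RingHom.ker_ne_top _ (top_le_iff.1 (h ▸ this))

lemma edgeIdeal_le_maxHomIdeal (G : SimpleGraph V) : edgeIdeal k G ≤ maxHomIdeal k V := by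
  rw [edgeIdeal, Ideal.span_le]
  rintro _ ⟨i, j, _, rfl⟩
  exact Ideal.mul_mem_right _ _ (Ideal.subset_span (Set.mem_range_self i))

lemma depthQuot_le_depthQuot [Finite V] {I I' : Ideal (MvPolynomial V k)}
    (hI : I ≤ maxHomIdeal k V)
    (h : ∀ i, ExtVanishes (maxHomIdeal k V) i (ModuleCat.of _ (MvPolynomial V k ⧸ I')) →
      ExtVanishes (maxHomIdeal k V) i (ModuleCat.of _ (MvPolynomial V k ⧸ I))) :
    depthQuot k I' ≤ depthQuot k I := by
  simp only [← subsingleton_localCohomology_iff] at h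
  have hne : {i : ℕ | Nontrivial ((localCohomology (maxHomIdeal k V) i).obj
      (ModuleCat.of (MvPolynomial V k) (MvPolynomial V k ⧸ I)))}.Nonempty := by
    obtain ⟨i, hi⟩ := exists_not_extVanishes hI maxHomIdeal_ne_top
    rw [← subsingleton_localCohomology_iff, not_subsingleton_iff_nontrivial] at hi
    exact ⟨i, hi⟩
  refine Nat.sInf_le ?_
  have := Nat.sInf_mem hne
  rw [Set.mem_ofPred_eq, ← not_subsingleton_iff_nontrivial] at this ⊢
  exact mt (h _) this

end

/-- If `G` has a leaf edge (an edge `{u, v}` where `v` is the unique neighbour of `u`),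
then the sequence `depth S/I(G)^t` is non-increasing. -/
theorem depth_powers_nonincreasing_of_leaf_edge (k : Type) [Field k] (n : ℕ)
    (G : SimpleGraph (Fin n)) (hleaf : ∃ u v, G.Adj u v ∧ G.neighborSet u = {v}) :
    ∀ t : ℕ, 2 ≤ t →
      depthQuot k ((edgeIdeal k G) ^ t) ≤ depthQuot k ((edgeIdeal k G) ^ (t - 1)) := by
  intro t ht
  obtain ⟨u, v, huv, hu⟩ := hleaf
  obtain ⟨t, rfl⟩ := Nat.exists_eq_add_of_le' (one_le_two.trans ht)
  exact depthQuot_le_depthQuot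
    ((Ideal.pow_le_self (by lia)).trans (edgeIdeal_le_maxHomIdeal G))
    fun i => ExtVanishes.edgeIdeal_pow huv hu
end

section
/- Let G be a finite simple graph on vertex set {x_1,…,x_n} and let e = {e_1,…,e_t} be a set of t distinct edges of G such that e, viewed as a subgraph of G with edge set {e_1,…,e_t}, is connected, and the induced subgraph G[e] of G on the closed neighbourhood N[e] is bipartite. Then in S = k[x_1,…,x_n], the colon ideal I(G)^{t+1} : (e_1 ⋯ e_t) equals I(H), where H is the graph obtained from G by bipartite completion of G[e], i.e., V(H) = V(G) and E(H) = E(G) ∪ E(K_{U,V}), where U ∪ V is the bipartition of N[e]. (Here each e_i is identified with the product of the two variables corresponding to its endpoints.) -/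
open MvPolynomial

/-- The monomial `x_i x_j` associated to an edge `{i, j}`. -/
noncomputable def edgeMonomial (k : Type) [Field k] {V : Type} (s : Sym2 V) :
    MvPolynomial V k :=
  Sym2.lift ⟨fun i j => X i * X j, fun i j => mul_comm _ _⟩ s

section EdgeIdeal

variable {k : Type} [Field k] {W : Type} {G : SimpleGraph W}

lemma edgeMonomial_mk (a b : W) : edgeMonomial k s(a, b) = X a * X b := rfl

lemma X_mul_X_mem_edgeIdeal {a b : W} (h : G.Adj a b) :
    (X a * X b : MvPolynomial W k) ∈ edgeIdeal k G :=
  Ideal.subset_span ⟨a, b, h, rfl⟩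

lemma edgeMonomial_mem_edgeIdeal {s : Sym2 W} (h : s ∈ G.edgeSet) :
    edgeMonomial k s ∈ edgeIdeal k G := by
  induction s with
  | _ a b => exact X_mul_X_mem_edgeIdeal h

lemma prod_edgeMonomial_mem_edgeIdeal_pow (F : Finset (Sym2 W)) (hF : ∀ s ∈ F, s ∈ G.edgeSet) :
    ∏ s ∈ F, edgeMonomial k s ∈ edgeIdeal k G ^ F.card := by
  rw [← Finset.prod_const]
  exact Ideal.prod_mem_prod fun s hs => edgeMonomial_mem_edgeIdeal (hF s hs)

/-- A polynomial lies in the edge ideal as soon as no monomial of it has independent support. -/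
lemma mem_edgeIdeal_of_forall_support {f : MvPolynomial W k}
    (h : ∀ m ∈ f.support, ∃ i j, G.Adj i j ∧ m i ≠ 0 ∧ m j ≠ 0) : f ∈ edgeIdeal k G := by
  classical
  have hs : edgeIdeal k G = Ideal.span ((fun m => monomial m (1 : k)) ''
      {m | ∃ i j, G.Adj i j ∧ m = Finsupp.single i 1 + Finsupp.single j 1}) := by
    rw [edgeIdeal]
    congr 1
    ext p
    constructor
    · rintro ⟨i, j, hij, rfl⟩
      exact ⟨_, ⟨i, j, hij, rfl⟩, by simp [X, monomial_mul]⟩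
    · rintro ⟨_, ⟨i, j, hij, rfl⟩, rfl⟩
      exact ⟨i, j, hij, by simp [X, monomial_mul]⟩
  rw [hs, mem_ideal_span_monomial_image]
  intro m hm
  obtain ⟨i, j, hij, hi, hj⟩ := h m hm
  refine ⟨_, ⟨i, j, hij, rfl⟩, fun x => ?_⟩
  have hne := hij.ne
  simp only [Finsupp.add_apply, Finsupp.single_apply]
  split_ifs with h₁ h₂ h₂
  · exact absurd (h₁.trans h₂.symm) hne
  · subst h₁; omega
  · subst h₂; omega
  · omega

/-- Neighbours `u`, `v` of the two ends of a walk of odd length are even-connected along it. -/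
lemma X_mul_X_mul_prod_edges_mem : ∀ {a b : W} (p : G.Walk a b), Odd p.length →
    ∀ {u v : W}, G.Adj u a → G.Adj b v →
      X u * X v * (p.edges.map (edgeMonomial k)).prod ∈ edgeIdeal k G ^ (p.length + 1)
  | _, _, .nil, hp, _, _, _, _ => by simp at hp
  | a, b, .cons _ .nil, _, u, v, hu, hv => by
    have := Ideal.mul_mem_mul (X_mul_X_mem_edgeIdeal (k := k) hu) (X_mul_X_mem_edgeIdeal hv)
    simp only [SimpleGraph.Walk.edges_cons, SimpleGraph.Walk.edges_nil, List.map_cons,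
      List.map_nil, List.prod_cons, List.prod_nil, edgeMonomial_mk, SimpleGraph.Walk.length_cons,
      SimpleGraph.Walk.length_nil]
    rw [show 0 + 1 + 1 = 2 from rfl, pow_two]
    convert this using 1
    ring
  | a, b, .cons (v := c) _ (.cons (v := d) hcd q), hp, u, v, hu, hv => by
    have hq : Odd q.length := by
      simp only [SimpleGraph.Walk.length_cons] at hp
      grind
    have := Ideal.mul_mem_mul (Ideal.mul_mem_mul (X_mul_X_mem_edgeIdeal (k := k) hu)
      (X_mul_X_mem_edgeIdeal hcd)) (X_mul_X_mul_prod_edges_mem q hq hcd hv)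
    simp only [SimpleGraph.Walk.edges_cons, List.map_cons, List.prod_cons, edgeMonomial_mk,
      SimpleGraph.Walk.length_cons]
    rw [← pow_two, ← pow_add, show 2 + (q.length + 1) = q.length + 1 + 1 + 1 by ring] at this
    convert this using 1
    ring

lemma X_mul_X_mul_prod_mem_of_isTrail {a b u v : W} (p : G.Walk a b) (hp : Odd p.length)
    (ht : p.IsTrail) (hu : G.Adj u a) (hv : G.Adj b v) (F : Finset (Sym2 W))
    (hF : ∀ s ∈ F, s ∈ G.edgeSet) (hpF : ∀ s ∈ p.edges, s ∈ F) :
    X u * X v * ∏ s ∈ F, edgeMonomial k s ∈ edgeIdeal k G ^ (F.card + 1) := by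
  classical
  have hsub : p.edges.toFinset ⊆ F := fun s hs => hpF s (List.mem_toFinset.1 hs)
  have hcard : p.edges.toFinset.card = p.length := by
    rw [List.toFinset_card_of_nodup ht.edges_nodup, SimpleGraph.Walk.length_edges]
  have hle := Finset.card_le_card hsub
  rw [← Finset.prod_sdiff hsub, List.prod_toFinset _ ht.edges_nodup,
    show F.card + 1 = (F \ p.edges.toFinset).card + (p.length + 1) by
      rw [Finset.card_sdiff_of_subset hsub]; omega, pow_add, mul_left_comm]
  exact Ideal.mul_mem_mul
    (prod_edgeMonomial_mem_edgeIdeal_pow _ fun s hs => hF s (Finset.mem_sdiff.1 hs).1)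
    (X_mul_X_mul_prod_edges_mem p hp hu hv)

/-- If `C` is a vertex cover meeting each edge of `F` in exactly one vertex, then
`I(G) ^ (|F| + 1) : ∏ F` is contained in the prime ideal generated by `C`. -/
lemma mem_span_X_of_mul_prod_mem (C : Set W) (hC : ∀ i j, G.Adj i j → i ∈ C ∨ j ∈ C)
    (F : Finset (Sym2 W)) (hF : ∀ s ∈ F, ∃ a b, s = s(a, b) ∧ a ∈ C ∧ b ∉ C)
    {f : MvPolynomial W k}
    (hf : f * ∏ s ∈ F, edgeMonomial k s ∈ edgeIdeal k G ^ (F.card + 1)) :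
    f ∈ Ideal.span ((X : W → MvPolynomial W k) '' C) := by
  classical
  let w : W → ℕ := fun i => if i ∈ C then 1 else 0
  let φ : MvPolynomial W k →ₐ[k] Polynomial (MvPolynomial W k) :=
    aeval fun i => Polynomial.X ^ w i * Polynomial.C (X i)
  have hφX : ∀ i, φ (X i) = Polynomial.X ^ w i * Polynomial.C (X i) := fun i => aeval_X _ i
  have hmap : (edgeIdeal k G).map φ ≤ Ideal.span {Polynomial.X} := by
    rw [edgeIdeal, Ideal.map_span, Ideal.span_le]
    rintro _ ⟨_, ⟨i, j, hij, rfl⟩, rfl⟩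
    rw [SetLike.mem_coe, Ideal.mem_span_singleton, map_mul, hφX, hφX]
    rcases hC i j hij with h | h
    · exact ((dvd_pow_self _ (by simp [w, h])).mul_right _).mul_right _
    · exact ((dvd_pow_self _ (by simp [w, h])).mul_right _).mul_left _
  have hE : φ (∏ s ∈ F, edgeMonomial k s) =
      Polynomial.X ^ F.card * Polynomial.C (∏ s ∈ F, edgeMonomial k s) := by
    rw [map_prod, map_prod, ← Finset.prod_const, ← Finset.prod_mul_distrib]
    refine Finset.prod_congr rfl fun s hs => ?_
    obtain ⟨a, b, rfl, ha, hb⟩ := hF s hs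
    rw [edgeMonomial_mk, map_mul, hφX, hφX, map_mul]
    simp only [w, ha, hb, if_true, if_false]
    ring
  have hE0 : ∏ s ∈ F, edgeMonomial k s ≠ 0 := by
    refine Finset.prod_ne_zero_iff.2 fun s hs => ?_
    obtain ⟨a, b, rfl, -, -⟩ := hF s hs
    exact mul_ne_zero (X_ne_zero a) (X_ne_zero b)
  have hdvd := (Ideal.pow_right_mono hmap (F.card + 1))
    (Ideal.map_pow φ (edgeIdeal k G) (F.card + 1) ▸ Ideal.mem_map_of_mem φ hf)
  rw [Ideal.span_singleton_pow, Ideal.mem_span_singleton, map_mul, hE, pow_succ,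
    mul_left_comm, mul_dvd_mul_iff_left (pow_ne_zero _ Polynomial.X_ne_zero),
    Polynomial.X_dvd_iff, Polynomial.coeff_mul_C, mul_eq_zero, or_iff_left hE0] at hdvd
  let θ : MvPolynomial W k →ₐ[k] MvPolynomial W k :=
    (Polynomial.aeval (0 : MvPolynomial W k)).restrictScalars k |>.comp φ
  have hθ : θ f = 0 := by
    simpa [θ, Polynomial.aeval_def, Polynomial.eval₂_eq_eval_map,
      ← Polynomial.coeff_zero_eq_eval_zero] using hdvd
  let I := Ideal.span ((X : W → MvPolynomial W k) '' C)
  have hmk : (Ideal.Quotient.mkₐ k I).comp θ = Ideal.Quotient.mkₐ k I := by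
    refine algHom_ext fun i => ?_
    simp only [θ, AlgHom.comp_apply, hφX]
    by_cases hi : i ∈ C
    · have : Ideal.Quotient.mk I (X i) = 0 :=
        Ideal.Quotient.eq_zero_iff_mem.2 (Ideal.subset_span ⟨i, hi, rfl⟩)
      simp [w, hi, this]
    · simp [w, hi]
  refine Ideal.Quotient.eq_zero_iff_mem.1 ?_
  have := DFunLike.congr_fun hmk f
  rw [AlgHom.comp_apply, hθ, map_zero] at this
  exact this.symm

end EdgeIdeal

section Bipartite

variable {W : Type} {G : SimpleGraph W} {e : G.Subgraph} {U V : Set W}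

/-- In a connected bipartite subgraph, vertices on opposite sides are joined by an odd trail. -/
lemma exists_isTrail_odd_of_connected (he : e.Connected)
    (hbip : ∀ a b, e.Adj a b → (a ∈ U ↔ b ∉ U)) {a b : W} (ha : a ∈ e.verts) (hb : b ∈ e.verts)
    (haU : a ∉ U) (hbU : b ∈ U) :
    ∃ p : G.Walk a b, Odd p.length ∧ p.IsTrail ∧ ∀ s ∈ p.edges, s ∈ e.edgeSet := by
  classical
  obtain ⟨q, hq⟩ := he.coe.exists_isPath ⟨a, ha⟩ ⟨b, hb⟩
  let c : e.coe.Coloring Bool := SimpleGraph.Coloring.mk (fun x => decide (x.1 ∈ U)) (by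
    intro x y hxy
    have := hbip _ _ hxy
    by_cases hx : x.1 ∈ U <;> simp_all)
  suffices h : ∃ p : G.Walk (e.hom ⟨a, ha⟩) (e.hom ⟨b, hb⟩),
      Odd p.length ∧ p.IsTrail ∧ ∀ s ∈ p.edges, s ∈ e.edgeSet from h
  refine ⟨q.map e.hom, ?_, ?_, ?_⟩
  · rw [SimpleGraph.Walk.length_map, ← Nat.not_even_iff_odd, c.even_length_iff_congr q]
    have hca : c ⟨a, ha⟩ = false := decide_eq_false haU
    have hcb : c ⟨b, hb⟩ = true := decide_eq_true hbU
    simp [hca, hcb]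
  · exact hq.isTrail.map SimpleGraph.Subgraph.hom_injective
  · intro s hs
    rw [SimpleGraph.Walk.edges_map, List.mem_map] at hs
    obtain ⟨r, hr, rfl⟩ := hs
    have := q.edges_subset_edgeSet hr
    induction r with
    | _ x y => exact this

/-- A vertex cover of `G` avoiding `A` and meeting each edge of `e` exactly in its end in `V`. -/
lemma exists_cover_of_disjoint {A : Set W}
    (hN : ∀ v ∈ e.verts, ∀ x, G.Adj v x → x ∈ U ∪ V) (hverts : e.verts ⊆ U ∪ V)
    (hdisj : Disjoint U V)
    (hbip : ∀ u v, G.Adj u v → u ∈ U ∪ V → v ∈ U ∪ V → (u ∈ U ∧ v ∈ V) ∨ (u ∈ V ∧ v ∈ U))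
    (hA : ∀ i ∈ A, ∀ j ∈ A, ¬ G.Adj i j) (hAV : Disjoint A V) :
    ∃ C : Set W, Disjoint A C ∧ (∀ i j, G.Adj i j → i ∈ C ∨ j ∈ C) ∧
      ∀ s ∈ e.edgeSet, ∃ a b, s = s(a, b) ∧ a ∈ C ∧ b ∉ C := by
  have hUV : ∀ x ∈ U, x ∉ V := fun _ hx => Set.disjoint_left.1 hdisj hx
  have hAV' : ∀ x ∈ A, x ∉ V := fun _ hx => Set.disjoint_left.1 hAV hx
  have key : ∀ i ∈ A, ∀ j, G.Adj j i → ¬ (j ∈ U ∧ j ∈ e.verts) := by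
    rintro i hi j hij ⟨hjU, hj⟩
    rcases hbip j i hij (Or.inl hjU) (hN j hj i hij) with h | h
    · exact hAV' i hi h.2
    · exact hUV j hjU h.1
  refine ⟨(A ∪ (U ∩ e.verts))ᶜ, ?_, ?_, ?_⟩
  · exact Set.disjoint_left.2 fun x hx hx' => hx' (Or.inl hx)
  · intro i j hij
    by_contra! h
    simp only [Set.mem_compl_iff, not_not] at h
    rcases h with ⟨hi | hi, hj | hj⟩
    · exact hA i hi j hj hij
    · exact key i hi j hij.symm hj
    · exact key j hj i hij hi
    · rcases hbip i j hij (Or.inl hi.1) (Or.inl hj.1) with h | h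
      · exact hUV j hj.1 h.2
      · exact hUV i hi.1 h.1
  · intro s hs
    induction s with
    | _ a b =>
      have hab : e.Adj a b := hs
      have hV : ∀ x ∈ V, x ∈ (A ∪ (U ∩ e.verts))ᶜ := by
        rintro x hx (h | h)
        · exact hAV' x h hx
        · exact hUV x h.1 hx
      rcases hbip a b hab.adj_sub (hverts hab.fst_mem) (hverts hab.snd_mem) with h | h
      · exact ⟨b, a, Sym2.eq_swap, hV b h.2, fun hc => hc (Or.inr ⟨h.1, hab.fst_mem⟩)⟩
      · exact ⟨a, b, rfl, hV a h.1, fun hc => hc (Or.inr ⟨h.2, hab.snd_mem⟩)⟩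

end Bipartite

/-- Let `e` be a set of `t` distinct edges of `G` (formalized as a subgraph `e` of `G` whose
vertices are exactly the endpoints of its `t` edges) which is connected as a subgraph of `G`,
and suppose the induced subgraph `G[e]` of `G` on the closed neighbourhood `N[e]` is
bipartite, with bipartition `N[e] = U ∪ V`.  Then
`I(G)^{t+1} : (e_1 ⋯ e_t) = I(H)`, where `H` is obtained from `G` by bipartite completion
of `G[e]`, i.e. `E(H) = E(G) ∪ E(K_{U,V})`. -/
theorem colon_power_by_product_of_connected_edges (k : Type) [Field k] (n t : ℕ)
    (G : SimpleGraph (Fin n)) (e : G.Subgraph)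
    (he_card : e.edgeSet.ncard = t) (he_supp : e.verts = e.support) (he_conn : e.Connected)
    (U V : Set (Fin n))
    (hUV : U ∪ V = ⋃ v ∈ e.support, insert v (G.neighborSet v))
    (hdisj : Disjoint U V)
    (hbip : ∀ u v, G.Adj u v → u ∈ U ∪ V → v ∈ U ∪ V → (u ∈ U ∧ v ∈ V) ∨ (u ∈ V ∧ v ∈ U))
    (H : SimpleGraph (Fin n))
    (hH : H = G ⊔ SimpleGraph.fromRel (fun u v => u ∈ U ∧ v ∈ V)) :
    Submodule.colon ((edgeIdeal k G) ^ (t + 1))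
        (Ideal.span {∏ s ∈ e.edgeSet.toFinite.toFinset, edgeMonomial k s}) =
      edgeIdeal k H := by
  classical
  set F := e.edgeSet.toFinite.toFinset with hFdef
  have hFmem : ∀ s, s ∈ F ↔ s ∈ e.edgeSet := fun s => by simp [hFdef]
  have hcard : F.card = t := by rw [← he_card, Set.ncard_eq_toFinset_card _ e.edgeSet.toFinite]
  have hFG : ∀ s ∈ F, s ∈ G.edgeSet := fun s hs => e.edgeSet_subset ((hFmem s).1 hs)
  rw [← he_supp] at hUV
  have hmem : ∀ x, x ∈ U ∪ V ↔ ∃ v ∈ e.verts, x = v ∨ G.Adj v x := fun x => by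
    rw [hUV]; simp
  have hN : ∀ v ∈ e.verts, ∀ x, G.Adj v x → x ∈ U ∪ V := fun v hv x hx =>
    (hmem x).2 ⟨v, hv, Or.inr hx⟩
  have hverts : e.verts ⊆ U ∪ V := fun x hx => (hmem x).2 ⟨x, hx, Or.inl rfl⟩
  have hnbr : ∀ x ∈ U ∪ V, ∃ v ∈ e.verts, G.Adj v x := fun x hx => by
    obtain ⟨v, hv, rfl | hvx⟩ := (hmem x).1 hx
    · rw [he_supp] at hv
      obtain ⟨y, hy⟩ := hv
      exact ⟨y, hy.snd_mem, hy.symm.adj_sub⟩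
    · exact ⟨v, hv, hvx⟩
  have hUnV : ∀ x ∈ U, x ∉ V := fun _ hx => Set.disjoint_left.1 hdisj hx
  have hcross : ∀ a b, G.Adj a b → a ∈ U ∪ V → b ∈ U ∪ V → (a ∈ U ↔ b ∉ U) := by
    intro a b hab ha hb
    have h := hbip a b hab ha hb
    have := hUnV a
    have := hUnV b
    tauto
  subst hcard
  apply le_antisymm
  · intro f hf
    rw [Ideal.mem_colon_span_singleton] at hf
    refine mem_edgeIdeal_of_forall_support fun m hm => ?_
    by_contra! hind
    let A : Set (Fin n) := {i | m i ≠ 0}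
    have hAH : ∀ i ∈ A, ∀ j ∈ A, ¬ H.Adj i j := fun i hi j hj hij => hj (hind i j hij hi)
    have hAG : ∀ i ∈ A, ∀ j ∈ A, ¬ G.Adj i j := fun i hi j hj hij =>
      hAH i hi j hj (by rw [hH]; exact Or.inl hij)
    have hA : Disjoint A V ∨ Disjoint A U := by
      by_contra! h
      obtain ⟨v, hvA, hv⟩ := Set.not_disjoint_iff.1 h.1
      obtain ⟨u, huA, hu⟩ := Set.not_disjoint_iff.1 h.2
      refine hAH u huA v hvA ?_
      rw [hH]
      exact Or.inr ⟨fun huv => hUnV u hu (huv ▸ hv), Or.inl ⟨hu, hv⟩⟩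
    obtain ⟨C, hAC, hC, heC⟩ : ∃ C : Set (Fin n), Disjoint A C ∧
        (∀ i j, G.Adj i j → i ∈ C ∨ j ∈ C) ∧
        ∀ s ∈ e.edgeSet, ∃ a b, s = s(a, b) ∧ a ∈ C ∧ b ∉ C := by
      rcases hA with h | h
      · exact exists_cover_of_disjoint hN hverts hdisj hbip hAG h
      · rw [Set.union_comm] at hverts
        refine exists_cover_of_disjoint (fun v hv x hx => (hN v hv x hx).symm) hverts hdisj.symm
          (fun u v huv hu hv => (hbip u v huv hu.symm hv.symm).symm) hAG h
    have hfC := mem_span_X_of_mul_prod_mem C hC F (fun s hs => heC s ((hFmem s).1 hs)) hf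
    obtain ⟨i, hiC, hi⟩ := mem_ideal_span_X_image.1 hfC m hm
    exact Set.disjoint_left.1 hAC hi hiC
  · have hUVmem : ∀ u ∈ U, ∀ v ∈ V, X u * X v * ∏ s ∈ F, edgeMonomial k s ∈
        edgeIdeal k G ^ (F.card + 1) := by
      intro u hu v hv
      obtain ⟨a, ha, hau⟩ := hnbr u (Or.inl hu)
      obtain ⟨b, hb, hbv⟩ := hnbr v (Or.inr hv)
      have haU : a ∉ U := fun h =>
        (hcross a u hau (hverts ha) (Or.inl hu)).1 h hu
      have hbU : b ∈ U := (hcross b v hbv (hverts hb) (Or.inr hv)).2 fun h => hUnV v h hv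
      obtain ⟨p, hp, hpt, hpe⟩ := exists_isTrail_odd_of_connected he_conn
        (fun x y hxy => hcross x y hxy.adj_sub (hverts hxy.fst_mem) (hverts hxy.snd_mem))
        ha hb haU hbU
      exact X_mul_X_mul_prod_mem_of_isTrail p hp hpt hau.symm hbv F hFG
        fun s hs => (hFmem s).2 (hpe s hs)
    rw [edgeIdeal, Ideal.span_le]
    rintro _ ⟨i, j, hij, rfl⟩
    rw [SetLike.mem_coe, Ideal.mem_colon_span_singleton]
    rw [hH] at hij
    rcases hij with hij | ⟨-, h | h⟩
    · rw [pow_succ']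
      exact Ideal.mul_mem_mul (X_mul_X_mem_edgeIdeal hij)
        (prod_edgeMonomial_mem_edgeIdeal_pow F hFG)
    · exact hUVmem i h.1 j h.2
    · rw [mul_comm (X i)]
      exact hUVmem j h.1 i h.2
end

section
/- Let k be a field, T a tree on d vertices x_1,…,x_d, and let G be the whisker graph of T: V(G) = {x_1,…,x_d,y_1,…,y_d} and E(G) = E(T) ∪ {{x_i,y_i} : 1 ≤ i ≤ d} (a Cohen-Macaulay tree of dimension d). Let I(G) ⊆ S = k[x_1,…,x_d,y_1,…,y_d] be its edge ideal. Then for every integer t with 2 ≤ t ≤ d − 2, depth(S/I(G)^{t+1}) ≤ d − t. -/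
open MvPolynomial

/-- The whisker graph of a graph `T` on `Fin d`. -/
def whiskerGraph {d : ℕ} (T : SimpleGraph (Fin d)) : SimpleGraph (Fin d ⊕ Fin d) :=
  SimpleGraph.fromRel (fun u v =>
    (∃ i j, T.Adj i j ∧ u = Sum.inl i ∧ v = Sum.inl j) ∨ (∃ i, u = Sum.inl i ∧ v = Sum.inr i))

section

open CategoryTheory Limits Abelian

lemma homology_map_injective {R : Type} [CommRing R] {S₁ S₂ : ShortComplex (ModuleCat.{0} R)}
    (φ : S₁ ⟶ S₂)
    (h : ∀ x : S₁.X₂, S₁.g x = 0 → φ.τ₂ x ∈ LinearMap.range S₂.f.hom →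
      x ∈ LinearMap.range S₁.f.hom) :
    Function.Injective (ShortComplex.homologyMap φ) := by
  rw [injective_iff_map_eq_zero]
  intro a ha
  obtain ⟨z, rfl⟩ := (ModuleCat.epi_iff_surjective S₁.homologyπ).1 inferInstance a
  have e1 : ∀ {S : ShortComplex (ModuleCat.{0} R)} (z : S.cycles),
      S.homologyπ z = 0 ↔ S.iCycles z ∈ LinearMap.range S.f.hom := by
    intro S z
    rw [← S.moduleCat_pOpcycles_eq_zero_iff, ← ConcreteCategory.comp_apply,
      ← S.homology_π_ι, ConcreteCategory.comp_apply]
    constructor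
    · intro h; rw [h, map_zero]
    · intro h
      exact (ModuleCat.mono_iff_injective S.homologyι).1 inferInstance (by rw [h, map_zero])
  rw [e1]
  refine h _ ?_ ?_
  · rw [← ConcreteCategory.comp_apply, S₁.iCycles_g]; rfl
  · rw [← ConcreteCategory.comp_apply, ShortComplex.homologyπ_naturality,
      ConcreteCategory.comp_apply, e1, ← ConcreteCategory.comp_apply,
      ShortComplex.cyclesMap_i, ConcreteCategory.comp_apply] at ha
    exact ha

namespace CategoryTheory.ProjectiveResolution
variable {R : Type} [CommRing R]

/-- The map induced on the complexes `Hom(-, Y)` by a chain map. -/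
noncomputable def linearYonedaMap {K L : ChainComplex (ModuleCat.{0} R) ℕ} (φ : K ⟶ L)
    (Y : ModuleCat.{0} R) :
    L.linearYonedaObj R Y ⟶ K.linearYonedaObj R Y :=
  (HomologicalComplex.unopFunctor _ _).map
    ((((linearYoneda R (ModuleCat.{0} R)).obj Y).rightOp.mapHomologicalComplex _).map φ).op

lemma isoExt_naturality {X X' Y : ModuleCat.{0} R} (P : ProjectiveResolution X)
    (P' : ProjectiveResolution X') {g : X' ⟶ X} (φ : Hom P' P g) (n : ℕ) :
    ((Ext R (ModuleCat.{0} R) n).map g.op).app Y ≫ (P'.isoExt n Y).hom =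
      (P.isoExt n Y).hom ≫ HomologicalComplex.homologyMap (linearYonedaMap φ.hom Y) n := by
  have h1 := isoLeftDerivedObj_inv_naturality g P' P φ.hom
    (by simpa using φ.hom_f_zero_comp_π_f_zero) ((linearYoneda R (ModuleCat.{0} R)).obj Y).rightOp n
  have h1' : ((Ext R (ModuleCat.{0} R) n).map g.op).app Y ≫
      (P'.isoLeftDerivedObj ((linearYoneda R (ModuleCat.{0} R)).obj Y).rightOp n).inv.unop =
      (P.isoLeftDerivedObj ((linearYoneda R (ModuleCat.{0} R)).obj Y).rightOp n).inv.unop ≫ _ :=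
    congrArg Quiver.Hom.unop h1
  have h2 := ShortComplex.homologyOpIso_inv_naturality
    ((HomologicalComplex.shortComplexFunctor _ _ n).map (linearYonedaMap φ.hom Y))
  have h2' := congrArg Quiver.Hom.unop h2
  refine (Category.assoc _ _ _).symm.trans ((congrArg (· ≫ _) h1').trans
    ((Category.assoc _ _ _).trans ?_))
  exact (congrArg (_ ≫ ·) h2'.symm).trans (Category.assoc _ _ _).symm

lemma extMk_zero_degree_eq_zero {C : Type*} [Category* C] [Abelian C] [HasExt C] {X Y : C}
    (P : ProjectiveResolution X) (f : P.complex.X 0 ⟶ Y) (hf : P.complex.d 1 0 ≫ f = 0)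
    (h : P.extMk f 1 rfl hf = 0) : f = 0 := by
  rw [← P.extEquivCohomologyClass.apply_eq_iff_eq,
    extEquivCohomologyClass_extMk, extEquivCohomologyClass_zero,
    CochainComplex.HomComplex.CohomologyClass.mk_eq_zero_iff,
    CochainComplex.HomComplex.Cocycle.toSingleMk_mem_coboundaries_iff _ _ _ _ _ 1 (by lia)] at h
  obtain ⟨g, hg⟩ := h
  rw [(CochainComplex.isZero_of_isStrictlyLE P.cochainComplex 0 1).eq_of_src g 0, comp_zero] at hg
  exact (cancel_epi (P.cochainComplexXIso (-((0 : ℕ) : ℤ)) 0 rfl).hom).1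
    (hg.symm.trans comp_zero.symm)

lemma ext_map_injective {X X' Y : ModuleCat.{0} R} (g : X' ⟶ X) (n : ℕ)
    (h : ∀ ξ : Abelian.Ext X Y n, (Abelian.Ext.mk₀ g).comp ξ (zero_add n) = 0 → ξ = 0) :
    Function.Injective (((Ext R (ModuleCat.{0} R) n).map g.op).app Y) := by
  let P := projectiveResolution X
  let P' := projectiveResolution X'
  let φ : Hom P' P g := ⟨lift g P' P, by rw [lift_commutes_zero]; simp⟩
  have key : Function.Injective (HomologicalComplex.homologyMap (linearYonedaMap φ.hom Y) n) := by
    apply homology_map_injective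
    rintro (x : P.complex.X n ⟶ Y) (hx : (P.complex.linearYonedaObj R Y).d _ _ x = 0)
      ⟨(y : P'.complex.X _ ⟶ Y),
        (hy : (P'.complex.linearYonedaObj R Y).d _ n y = φ.hom.f n ≫ x)⟩
    have hx' : P.complex.d (n+1) n ≫ x = 0 := by
      rw [CochainComplex.next] at hx
      exact hx
    cases n with
    | zero =>
      have hy0 : φ.hom.f 0 ≫ x = 0 := by
        rw [← hy, HomologicalComplex.shape _ _ _ (by simp)]; rfl
      have h0 : P.extMk x 1 rfl hx' = 0 := by
        apply h
        rw [mk₀_comp_extMk x 1 rfl hx' φ]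
        simp only [hy0, extMk_zero]
      rw [extMk_zero_degree_eq_zero P x hx' h0]
      exact Submodule.zero_mem _
    | succ n =>
      have main : ∀ m, m = n → ∀ y : P'.complex.X m ⟶ Y,
          P'.complex.d (n + 1) m ≫ y = φ.hom.f (n + 1) ≫ x →
          ∃ y' : P.complex.X m ⟶ Y, P.complex.d (n + 1) m ≫ y' = x := by
        rintro m rfl y hy
        rw [← P.extMk_eq_zero_iff x _ rfl hx' m rfl]
        apply h
        rw [mk₀_comp_extMk x _ rfl hx' φ, P'.extMk_eq_zero_iff _ _ rfl _ m rfl]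
        exact ⟨y, hy⟩
      exact main _ (CochainComplex.prev_nat_succ n) y hy
  have := isoExt_naturality P P' φ n (Y := Y)
  have h2 : ⇑((P'.isoExt n Y).hom) ∘ ((Ext R (ModuleCat.{0} R) n).map g.op).app Y =
    HomologicalComplex.homologyMap (linearYonedaMap φ.hom Y) n ∘ (P.isoExt n Y).hom := by
    ext z
    exact congr($this z)
  refine Function.Injective.of_comp (f := (P'.isoExt n Y).hom) ?_
  rw [h2]
  exact key.comp ((ModuleCat.mono_iff_injective _).1 inferInstance)

lemma ext_eq_zero_of_isZero {X Y : ModuleCat.{0} R} (n : ℕ)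
    (h : IsZero (((Ext R (ModuleCat.{0} R) n).obj (Opposite.op X)).obj Y))
    (ξ : Abelian.Ext X Y n) : ξ = 0 := by
  let P := projectiveResolution X
  have hex := (ShortComplex.exact_iff_isZero_homology
    ((P.complex.linearYonedaObj R Y).sc n)).2 (h.of_iso (P.isoExt n Y).symm)
  rw [ShortComplex.moduleCat_exact_iff] at hex
  obtain ⟨x, hx, rfl⟩ := P.extMk_surjective ξ (n + 1) rfl
  have hx' : ((P.complex.linearYonedaObj R Y).sc n).g x = 0 := by
    change (P.complex.linearYonedaObj R Y).d _ _ x = 0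
    rw [CochainComplex.next]
    exact hx
  obtain ⟨(y : P.complex.X _ ⟶ Y), (hy : (P.complex.linearYonedaObj R Y).d _ n y = x)⟩ :=
    hex x hx'
  cases n with
  | zero =>
    have hx0 : x = 0 := by
      rw [← hy, HomologicalComplex.shape _ _ _ (by simp)]; rfl
    simp only [hx0, extMk_zero]
  | succ n =>
    have main : ∀ m, m = n → ∀ y : P.complex.X m ⟶ Y,
        P.complex.d (n + 1) m ≫ y = x → P.extMk x (n + 1 + 1) rfl hx = 0 := by
      rintro m rfl y hy
      rw [P.extMk_eq_zero_iff x _ rfl hx m rfl]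
      exact ⟨y, hy⟩
    exact main _ (CochainComplex.prev_nat_succ n) y hy

end CategoryTheory.ProjectiveResolution

open CategoryTheory.ProjectiveResolution in
/-- If `H^i_J(M) = 0` and the transition maps `Ext^i(R/J^m, M) → Ext^i(R/J^n, M)` of the direct
system computing it are injective, then `Ext^i(R/J^m, M) = 0`. -/
lemma localCohomology_ext {R : Type} [CommRing R] (J : Ideal R) (i : ℕ) (M : ModuleCat.{0} R)
    (h : IsZero ((localCohomology J i).obj M)) (m : ℕ)
    (hinj : ∀ (n : ℕ) (hmn : m ≤ n) (ξ : Abelian.Ext (ModuleCat.of R (R ⧸ J ^ m)) M i),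
      (Abelian.Ext.mk₀ (ModuleCat.ofHom (Submodule.mapQ (J ^ n) (J ^ m) LinearMap.id
        (Ideal.pow_le_pow_right hmn) : (R ⧸ J ^ n) →ₗ[R] (R ⧸ J ^ m)))).comp ξ (zero_add i) = 0 → ξ = 0)
    (ξ : Abelian.Ext (ModuleCat.of R (R ⧸ J ^ m)) M i) : ξ = 0 := by
  apply ext_eq_zero_of_isZero
  have := localCohomology.hasColimitDiagram (localCohomology.idealPowersDiagram J) i
  let F := localCohomology.diagram (localCohomology.idealPowersDiagram J) i
  let c := ((evaluation (ModuleCat.{0} R) (ModuleCat.{0} R)).obj M).mapCocone (colimit.cocone F)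
  have hc : IsColimit c := isColimitOfPreserves _ (colimit.isColimit F)
  have hsub : Subsingleton c.pt := ModuleCat.subsingleton_of_isZero h
  rw [ModuleCat.isZero_iff_subsingleton]
  have h0 : ∀ z : (((Ext R (ModuleCat.{0} R) i).obj
      (Opposite.op (ModuleCat.of R (R ⧸ J ^ m)))).obj M), z = 0 := by
    intro z
    obtain ⟨k, f, g, hfg⟩ := Concrete.isColimit_exists_of_rep_eq _ hc
      (i := Opposite.op (Opposite.op m)) (j := Opposite.op (Opposite.op m)) z 0
      (hsub.elim _ _)
    rw [map_zero] at hfg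
    have hmn : m ≤ k.unop.unop := f.unop.unop.down.down
    have := ext_map_injective _ i (hinj _ hmn)
    exact this (hfg.trans (map_zero _).symm)
  exact ⟨fun a b => (h0 a).trans (h0 b).symm⟩

lemma shortExact_ofHom {R : Type} [CommRing R] {N₁ N₂ N₃ : Type}
    [AddCommGroup N₁] [Module R N₁] [AddCommGroup N₂] [Module R N₂]
    [AddCommGroup N₃] [Module R N₃] (f : N₁ →ₗ[R] N₂) (g : N₂ →ₗ[R] N₃)
    (hf : Function.Injective f) (hg : Function.Surjective g) (h : Function.Exact f g) :
    (ShortComplex.mk (ModuleCat.ofHom f) (ModuleCat.ofHom g)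
      (by ext x; exact h.apply_apply_eq_zero x)).ShortExact where
  exact := (ShortComplex.ShortExact.moduleCat_exact_iff_function_exact _).mpr h
  mono_f := (ModuleCat.mono_iff_injective _).mpr hf
  epi_g := (ModuleCat.epi_iff_surjective _).mpr hg

lemma ext_eq_zero_of_pow_smul_eq_zero {R : Type} [CommRing R] [IsNoetherianRing R]
    (J : Ideal R) [J.IsMaximal] (M : ModuleCat.{0} R) (i : ℕ)
    (h : ∀ ξ : Ext (ModuleCat.of R (R ⧸ J)) M i, ξ = 0)
    (N : Type) [AddCommGroup N] [Module R N] [hN : Module.Finite R N]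
    (n : ℕ) (hn : ∀ r ∈ J ^ n, ∀ x : N, r • x = 0) (ξ : Ext (ModuleCat.of R N) M i) :
    ξ = 0 := by
  revert ξ hn
  induction hN using IsNoetherianRing.induction_on_isQuotientEquivQuotientPrime R with
  | subsingleton N =>
    intro _ ξ
    have : IsZero (ModuleCat.of R N) := ModuleCat.isZero_iff_subsingleton.2 ‹_›
    rw [← Ext.mk₀_id_comp ξ, this.eq_of_src (𝟙 _) 0, Ext.mk₀_zero, Ext.zero_comp]
  | quotient N p e =>
    intro hn ξ
    have hp : J ≤ p.1 := by
      refine p.2.le_of_pow_le (n := n) fun r hr => ?_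
      have := hn r hr (e.symm 1)
      rw [← map_smul, LinearEquiv.map_eq_zero_iff] at this
      rw [← Ideal.Quotient.eq_zero_iff_mem]
      simpa [Algebra.smul_def] using this
    have hp : J = p.1 := (Ideal.IsMaximal.eq_of_le ‹_› p.2.ne_top hp)
    rw [hp] at h
    have := h ((Ext.mk₀ (ModuleCat.ofHom e.symm.toLinearMap)).comp ξ (zero_add _))
    rw [← Ext.mk₀_id_comp ξ]
    have h2 : 𝟙 (ModuleCat.of R N) =
        ModuleCat.ofHom e.toLinearMap ≫ ModuleCat.ofHom e.symm.toLinearMap := by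
      ext; simp
    rw [h2, ← Ext.mk₀_comp_mk₀_assoc, this, Ext.comp_zero]
  | exact N₁ N₂ N₃ f g hf hg hfg h₁ h₃ =>
    intro hn ξ
    have hS := shortExact_ofHom f g hf hg hfg
    have h₁ := h₁ fun r hr x => hf (by rw [map_smul, hn r hr, map_zero])
    have h₃ := h₃ fun r hr x => by
      obtain ⟨x, rfl⟩ := hg x
      rw [← map_smul, hn r hr, map_zero]
    obtain ⟨x, rfl⟩ := Ext.contravariant_sequence_exact₂ hS _ ξ (h₁ _)
    rw [h₃ x, Ext.comp_zero]

/-- Vanishing of `H^i_J(M)` for `i ≤ r` implies vanishing of `Ext^i(R/J, M)` for `i ≤ r`. -/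
lemma ext_eq_zero_of_localCohomology_isZero {R : Type} [CommRing R] [IsNoetherianRing R]
    (J : Ideal R) [hJ : J.IsMaximal] (M : ModuleCat.{0} R) (r : ℕ)
    (h : ∀ i ≤ r, IsZero ((localCohomology J i).obj M)) (i : ℕ) (hi : i ≤ r)
    (ξ : Ext (ModuleCat.of R (R ⧸ J)) M i) : ξ = 0 := by
  obtain ⟨K, hK, hKM⟩ : ∃ K : Ideal R, K = J ^ 1 ∧ K = J := ⟨J, (pow_one J).symm, rfl⟩
  revert ξ
  rw [← hKM]
  have hKmax : K.IsMaximal := hKM ▸ hJ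
  induction i using Nat.strong_induction_on with
  | _ i ih =>
    rw [hK]
    apply localCohomology_ext J i M (h i hi) 1
    intro n hmn ξ hξ
    have hsurj : Function.Surjective (Submodule.mapQ (J ^ n) (J ^ 1) LinearMap.id
        (Ideal.pow_le_pow_right hmn) : (R ⧸ J ^ n) →ₗ[R] (R ⧸ J ^ 1)) := by
      intro x
      obtain ⟨x, rfl⟩ := Submodule.Quotient.mk_surjective _ x
      exact ⟨Submodule.Quotient.mk x, rfl⟩
    cases i with
    | zero =>
      have : Epi (ModuleCat.ofHom (Submodule.mapQ (J ^ n) (J ^ 1) LinearMap.id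
          (Ideal.pow_le_pow_right hmn) : (R ⧸ J ^ n) →ₗ[R] (R ⧸ J ^ 1))) := (ModuleCat.epi_iff_surjective _).2 hsurj
      exact Ext.precomp_mk₀_injective_of_epi M _ (hξ.trans (map_zero _).symm)
    | succ i =>
      have hS := LinearMap.shortExact_shortComplexKer hsurj
      obtain ⟨x, rfl⟩ := Ext.contravariant_sequence_exact₃ hS M ξ hξ (add_comm 1 i)
      rw [ext_eq_zero_of_pow_smul_eq_zero K M i (ih i (by lia) (by lia)) _ n ?_ x, Ext.comp_zero]
      rintro r hr ⟨x, hx⟩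
      ext
      obtain ⟨x, rfl⟩ := Submodule.Quotient.mk_surjective _ x
      change r • Submodule.Quotient.mk x = _
      rw [← Submodule.Quotient.mk_smul]
      refine (Submodule.Quotient.mk_eq_zero _).2 ?_
      exact Ideal.mul_mem_right _ _ (hKM ▸ hr)

/-- If `f` with nonzero constant term maps a finite module `E` into `X v • E`, then some polynomial
with nonzero constant term annihilates `E`. -/
lemma exists_smul_eq_zero_of_smul_mem {σ k : Type} [Field k] (E : Type*) [AddCommGroup E]
    [Module (MvPolynomial σ k) E] [Module.Finite (MvPolynomial σ k) E] (v : σ)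
    (f : MvPolynomial σ k) (hf : constantCoeff f ≠ 0)
    (h : ∀ x : E, ∃ y : E, f • x = (X v : MvPolynomial σ k) • y) :
    ∃ g : MvPolynomial σ k, constantCoeff g ≠ 0 ∧ ∀ x : E, g • x = 0 := by
  obtain ⟨p, hp, hc, h0⟩ :=
    LinearMap.exists_monic_and_natDegree_eq_and_coeff_mem_pow_and_aeval_eq_zero (MvPolynomial σ k)
      (f • (LinearMap.id : E →ₗ[MvPolynomial σ k] E)) (Ideal.span {X v}) (by
        rintro _ ⟨x, rfl⟩
        obtain ⟨y, hy⟩ := h x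
        simp only [LinearMap.smul_apply, LinearMap.id_apply, hy]
        exact Submodule.smul_mem_smul (Ideal.subset_span rfl) trivial)
  refine ⟨p.eval f, ?_, fun x => ?_⟩
  · have hmod : p.map (constantCoeff (R := k) (σ := σ)) = Polynomial.X ^ p.natDegree := by
      ext j
      rw [Polynomial.coeff_map, Polynomial.coeff_X_pow]
      rcases lt_trichotomy j p.natDegree with hj | rfl | hj
      · have := Ideal.pow_le_self (by lia) (h0.1 j)
        rw [Ideal.mem_span_singleton] at this
        obtain ⟨q, hq⟩ := this
        rw [hq, if_neg hj.ne]; simp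
      · simp [hp]
      · rw [Polynomial.coeff_eq_zero_of_natDegree_lt hj, if_neg hj.ne']; simp
    rw [← Polynomial.eval_map_apply, hmod]
    simpa using pow_ne_zero _ hf
  · have h1 : ∀ q : Polynomial (MvPolynomial σ k),
        Polynomial.aeval (f • (LinearMap.id : E →ₗ[MvPolynomial σ k] E)) q = q.eval f • LinearMap.id := by
      intro q
      induction q using Polynomial.induction_on' with
      | add p q hp hq => simp [hp, hq, add_smul]
      | monomial n a =>
        ext x
        simp [Polynomial.aeval_monomial, smul_pow, Module.algebraMap_end_apply, smul_smul, mul_comm a]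
    have := h0.2
    rw [h1] at this
    exact congr($this x)

/-- If `Ext^i(k, M) = 0` for `i ≤ r`, then `Ext^i(S/P, M)` vanishes after localizing at the origin
whenever `P` is generated by variables and `i + dim S/P ≤ r`. -/
lemma exists_smul_ext_eq_zero {σ k : Type} [Field k] [Fintype σ] [DecidableEq σ]
    (M : ModuleCat.{0} (MvPolynomial σ k)) [Module.Finite (MvPolynomial σ k) M] (r : ℕ)
    (h : ∀ i ≤ r, ∀ ξ : Ext (ModuleCat.of (MvPolynomial σ k) (MvPolynomial σ k ⧸
      Ideal.span (Set.range (X : σ → MvPolynomial σ k)))) M i, ξ = 0)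
    (c : ℕ) : ∀ (i : ℕ) (_ : i + c ≤ r) (W : Finset σ) (_ : Wᶜ.card = c),
    ∃ g : MvPolynomial σ k, constantCoeff g ≠ 0 ∧
      ∀ ξ : Ext (ModuleCat.of (MvPolynomial σ k) (MvPolynomial σ k ⧸
        Ideal.span ((X : σ → MvPolynomial σ k) '' (W : Set σ)))) M i, g • ξ = 0 := by
  induction c with
  | zero =>
    intro i hi W hW
    refine ⟨1, by simp, ?_⟩
    obtain rfl : W = Finset.univ := by simpa using hW
    rw [Finset.coe_univ, Set.image_univ]
    intro ξ
    rw [h i (by lia) ξ, smul_zero]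
  | succ c ih =>
    intro i hi W hW
    obtain ⟨v, hv⟩ : Wᶜ.Nonempty := Finset.card_pos.1 (by lia)
    obtain ⟨f, hf, hfE⟩ := ih (i + 1) (by lia) (insert v W) (by
      rw [Finset.compl_insert, Finset.card_erase_of_mem hv]; lia)
    have hvW : v ∉ W := by simpa using hv
    let P := Ideal.span ((X : σ → MvPolynomial σ k) '' (W : Set σ))
    let Q := Ideal.span ((X : σ → MvPolynomial σ k) '' (insert v W : Finset σ))
    have hPQ : P ≤ Q := Ideal.span_mono (Set.image_mono (by simp))
    have hQ : Q = Ideal.span {X v} ⊔ P := by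
      simp only [Q, P, Finset.coe_insert, Set.image_insert_eq, Ideal.span_insert]
    let φ : (MvPolynomial σ k ⧸ P) →ₗ[MvPolynomial σ k] (MvPolynomial σ k ⧸ P) :=
      (X v : MvPolynomial σ k) • LinearMap.id
    let ψ : (MvPolynomial σ k ⧸ P) →ₗ[MvPolynomial σ k] (MvPolynomial σ k ⧸ Q) :=
      Submodule.mapQ P Q LinearMap.id hPQ
    have hreg : ∀ x : MvPolynomial σ k, X v * x ∈ P → x ∈ P := by
      intro x hx
      simp only [P, mem_ideal_span_X_image] at hx ⊢
      intro m hm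
      obtain ⟨j, hj, hne⟩ := hx (Finsupp.single v 1 + m) (by
        rw [mem_support_iff] at hm ⊢
        rwa [coeff_X_mul])
      refine ⟨j, hj, ?_⟩
      have : v ≠ j := by rintro rfl; exact hvW hj
      simpa [Finsupp.single_apply, this] using hne
    have hS := shortExact_ofHom φ ψ ?_ ?_ ?_
    rotate_left
    · rw [injective_iff_map_eq_zero]
      intro x hx
      obtain ⟨x, rfl⟩ := Submodule.Quotient.mk_surjective _ x
      change (X v : MvPolynomial σ k) • Submodule.Quotient.mk (p := P) x = 0 at hx
      rw [← Submodule.Quotient.mk_smul, Submodule.Quotient.mk_eq_zero] at hx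
      rw [Submodule.Quotient.mk_eq_zero]
      exact hreg x hx
    · intro x
      obtain ⟨x, rfl⟩ := Submodule.Quotient.mk_surjective _ x
      exact ⟨Submodule.Quotient.mk x, rfl⟩
    · intro x
      constructor
      · obtain ⟨x, rfl⟩ := Submodule.Quotient.mk_surjective _ x
        intro hx
        have hx : x ∈ Q := (Submodule.Quotient.mk_eq_zero _).1 hx
        rw [hQ, Submodule.mem_sup] at hx
        obtain ⟨a, ha, b, hb, rfl⟩ := hx
        obtain ⟨q, rfl⟩ := Ideal.mem_span_singleton.1 ha
        refine ⟨Submodule.Quotient.mk (p := P) q, ?_⟩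
        change (X v : MvPolynomial σ k) • Submodule.Quotient.mk (p := P) q = _
        rw [← Submodule.Quotient.mk_smul, eq_comm, Submodule.Quotient.eq]
        simpa using hb
      · rintro ⟨x, rfl⟩
        obtain ⟨x, rfl⟩ := Submodule.Quotient.mk_surjective _ x
        change ψ ((X v : MvPolynomial σ k) • Submodule.Quotient.mk (p := P) x) = 0
        rw [← Submodule.Quotient.mk_smul]
        refine (Submodule.Quotient.mk_eq_zero Q).2 ?_
        rw [hQ]
        exact Ideal.mul_mem_right _ _ (Ideal.mem_sup_left (Ideal.subset_span rfl))
    refine exists_smul_eq_zero_of_smul_mem (Ext (ModuleCat.of (MvPolynomial σ k)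
      (MvPolynomial σ k ⧸ P)) M i) v f hf fun x => ?_
    have hδ : hS.extClass.comp (f • x) (add_comm 1 i) = 0 := by
      rw [Ext.comp_smul]; exact hfE _
    obtain ⟨y, hy⟩ := Ext.contravariant_sequence_exact₁ hS M (f • x) _ hδ
    refine ⟨y, ?_⟩
    have hy' : (Ext.mk₀ ((X v : MvPolynomial σ k) • 𝟙 (ModuleCat.of (MvPolynomial σ k)
      (MvPolynomial σ k ⧸ P)))).comp y (zero_add i) = f • x := hy
    rw [← hy', Ext.mk₀_smul, Ext.smul_comp, Ext.mk₀_id_comp]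

lemma exists_extension_of_smul_ext_eq_zero {R : Type} [CommRing R] (p N : Ideal R) (f : R)
    (hf : ∀ ξ : Ext (ModuleCat.of R (R ⧸ p)) (ModuleCat.of R (R ⧸ N)) 1, f • ξ = 0)
    (φ : p →ₗ[R] R ⧸ N) :
    ∃ g : R, ∀ z : p, f • φ z = Ideal.Quotient.mk N (z * g) := by
  have hS := shortExact_ofHom p.subtype p.mkQ p.injective_subtype p.mkQ_surjective
    (LinearMap.exact_subtype_mkQ p)
  obtain ⟨y, hy⟩ := Ext.contravariant_sequence_exact₁ hS (ModuleCat.of R (R ⧸ N))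
    (f • Ext.mk₀ (ModuleCat.ofHom φ)) (add_comm 1 0) (by rw [Ext.comp_smul]; exact hf _)
  obtain ⟨ψ, rfl⟩ := Ext.addEquiv₀.symm.surjective y
  rw [← Ext.mk₀_smul, Ext.addEquiv₀_symm_apply, Ext.mk₀_comp_mk₀] at hy
  have h := Ext.addEquiv₀.symm.injective hy
  obtain ⟨g, hg⟩ := Ideal.Quotient.mk_surjective (ψ.hom (1 : R))
  refine ⟨g, fun z => ?_⟩
  have h1 : ψ.hom (z : R) = f • φ z := congr($h z)
  rw [← h1, map_mul, hg]
  have h2 := ψ.hom.map_smul (z : R) (1 : R)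
  rw [smul_eq_mul, mul_one] at h2
  rw [h2]
  exact Algebra.smul_def _ _

lemma sub_aeval_mem_span_X {σ k : Type} [Field k] [DecidableEq σ] (D : Finset σ)
    (s : MvPolynomial σ k) :
    aeval (fun v => if v ∈ D then 0 else (X v : MvPolynomial σ k)) s - s ∈
      Ideal.span ((X : σ → MvPolynomial σ k) '' (D : Set σ)) := by
  induction s using induction_on with
  | C a => simp
  | add p q hp hq =>
    rw [map_add, add_sub_add_comm]
    exact add_mem hp hq
  | mul_X p v hp =>
    rw [map_mul, aeval_X]
    split_ifs with h
    · rw [mul_zero, zero_sub, neg_mem_iff]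
      exact Ideal.mul_mem_left _ _ (Ideal.subset_span ⟨v, h, rfl⟩)
    · rw [← sub_mul]
      exact Ideal.mul_mem_right _ _ hp

lemma constantCoeff_eq_zero_of_smul_ext_one_eq_zero {σ k : Type} [Field k] [DecidableEq σ]
    (N : Ideal (MvPolynomial σ k)) (A B C : Finset σ) (hBA : Disjoint B (A ∪ C)) (m : σ →₀ ℕ)
    (hAB : ∀ a ∈ A, ∀ b ∈ B, monomial m 1 * (X a * X b) ∈ N)
    (hC : ∀ c ∈ C, monomial m 1 * X c ∈ N)
    (α β : σ) (hα : α ∈ A) (hβ : β ∈ B)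
    (hNα : ∀ q ∈ N, coeff (Finsupp.single α 1 + m) q = 0)
    (hNβ : ∀ q ∈ N, coeff (Finsupp.single β 1 + m) q = 0)
    (f : MvPolynomial σ k)
    (hf : ∀ ξ : Ext (ModuleCat.of (MvPolynomial σ k) (MvPolynomial σ k ⧸
        Ideal.span ((X : σ → MvPolynomial σ k) '' ((A ∪ B ∪ C : Finset σ) : Set σ))))
        (ModuleCat.of (MvPolynomial σ k) (MvPolynomial σ k ⧸ N)) 1, f • ξ = 0) :
    constantCoeff f = 0 := by
  let p := Ideal.span ((X : σ → MvPolynomial σ k) '' ((A ∪ B ∪ C : Finset σ) : Set σ))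
  let PA := Ideal.span ((X : σ → MvPolynomial σ k) '' ((A ∪ C : Finset σ) : Set σ))
  let PB := Ideal.span ((X : σ → MvPolynomial σ k) '' ((B ∪ C : Finset σ) : Set σ))
  let u : MvPolynomial σ k := monomial m 1
  let τ := aeval (R := k) (fun v => if v ∈ A ∪ C then 0 else (X v : MvPolynomial σ k))
  have hPAB : ∀ a ∈ PA, ∀ b ∈ PB, u * (a * b) ∈ N := by
    have : Ideal.span {u} * (PA * PB) ≤ N := by
      rw [Ideal.span_mul_span', Ideal.span_mul_span', Ideal.span_le]
      rintro _ ⟨_, rfl, _, ⟨_, ⟨a, ha, rfl⟩, _, ⟨b, hb, rfl⟩, rfl⟩, rfl⟩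
      have ha : a ∈ A ∨ a ∈ C := by simpa using ha
      have hb : b ∈ B ∨ b ∈ C := by simpa using hb
      change u * (X a * X b) ∈ N
      rcases ha with ha | ha
      · rcases hb with hb | hb
        · exact hAB a ha b hb
        · rw [mul_left_comm]
          exact Ideal.mul_mem_left _ _ (hC b hb)
      · rw [← mul_assoc]
        exact Ideal.mul_mem_right _ _ (hC a ha)
    exact fun a ha b hb => this (Ideal.mul_mem_mul (Ideal.mem_span_singleton_self u)
      (Ideal.mul_mem_mul ha hb))
  have hτ : ∀ z ∈ p, τ z ∈ PB := by
    intro z hz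
    have : p ≤ PB.comap τ := by
      rw [Ideal.span_le]
      rintro _ ⟨v, hv, rfl⟩
      have hv : v ∈ A ∨ v ∈ B ∨ v ∈ C := by simpa [or_assoc] using hv
      change τ (X v) ∈ PB
      simp only [τ, aeval_X]
      split_ifs with h
      · exact zero_mem _
      · refine Ideal.subset_span ⟨v, ?_, rfl⟩
        simp at h ⊢
        tauto
    exact this hz
  let φ : p →ₗ[MvPolynomial σ k] MvPolynomial σ k ⧸ N :=
    { toFun := fun z => Ideal.Quotient.mk N (u * τ z)
      map_add' := fun x y => by
        rw [← map_add, ← mul_add, ← map_add]; rfl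
      map_smul' := fun s z => by
        change _ = Ideal.Quotient.mk N (s * (u * τ z))
        rw [Ideal.Quotient.eq]
        have := hPAB _ (sub_aeval_mem_span_X (A ∪ C) s) _ (hτ z z.2)
        convert this using 1
        rw [Submodule.coe_smul, smul_eq_mul, map_mul]
        ring }
  obtain ⟨g, hg⟩ := exists_extension_of_smul_ext_eq_zero p N f hf φ
  have hg' : ∀ v ∈ A ∪ B ∪ C, f * (u * τ (X v)) - X v * g ∈ N := by
    intro v hv
    have := hg ⟨X v, Ideal.subset_span ⟨v, hv, rfl⟩⟩
    change Ideal.Quotient.mk N (f * (u * τ (X v))) = _ at this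
    rwa [Ideal.Quotient.eq] at this
  have h1 := hNα _ (hg' α (by simp [hα]))
  have h2 := hNβ _ (hg' β (by simp [hβ]))
  have hβ' : β ∉ A ∪ C := Finset.disjoint_left.1 hBA hβ
  have hα' : α ∈ A ∪ C := by simp [hα]
  simp only [τ, aeval_X, if_pos hα', mul_zero, zero_sub, coeff_neg,
    coeff_X_mul, neg_eq_zero] at h1
  simp only [τ, aeval_X, if_neg hβ', coeff_sub,
    coeff_X_mul, h1, sub_zero] at h2
  rw [show f * (u * X β) = X β * (f * u) by ring,
    coeff_X_mul, coeff_mul_monomial'] at h2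
  simpa [constantCoeff_eq] using h2

end

/-- The properties of a product `u` of `t` edges spanning a subtree on the vertex set `s` of a tree
with two-colouring `c`; the whisker at `i` gets the colour opposite to that of `i`. -/
structure IsTreeMonomial {V R : Type*} [CommRing R] (I : Ideal R) (Z : V ⊕ V → R) (c : V → Bool)
    (t : ℕ) (s : Finset V) (u : R) : Prop where
  mem : u ∈ I ^ t
  same : ∀ w ∈ s, ∀ β : V ⊕ V, Sum.elim id id β ∈ s → Sum.elim c (fun i => !c i) β = c w →
    ∃ q ∈ I ^ t, Z β * u = Z (Sum.inl w) * q
  opp : ∀ α β : V ⊕ V, Sum.elim id id α ∈ s → Sum.elim id id β ∈ s →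
    Sum.elim c (fun i => !c i) α ≠ Sum.elim c (fun i => !c i) β → u * (Z α * Z β) ∈ I ^ (t + 1)
  dvd : ∀ w ∈ s, ∀ w' ∈ s, c w ≠ c w' →
    ∃ r, r + 1 = t ∧ ∃ q ∈ I ^ r, u = Z (Sum.inl w) * Z (Sum.inl w') * q

lemma IsTreeMonomial.singleton {V R : Type*} [CommRing R] (I : Ideal R) (Z : V ⊕ V → R)
    (c : V → Bool) (v : V) (hv : Z (Sum.inl v) * Z (Sum.inr v) ∈ I) :
    IsTreeMonomial I Z c 0 {v} 1 where
  mem := by simp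
  same := by
    rintro w hw (j | j) hj hc <;> simp at hw hj <;> subst hw hj
    · exact ⟨1, by simp, rfl⟩
    · simp at hc
  opp := by
    rintro (i | i) (j | j) hi hj hc <;> simp at hi hj <;> subst hi hj <;> simp at hc
    · simpa using hv
    · simpa [mul_comm] using hv
  dvd := by simp

lemma Ideal.mul_mem_pow_succ {R : Type*} [CommRing R] {I : Ideal R} {n : ℕ} {a b : R}
    (ha : a ∈ I) (hb : b ∈ I ^ n) : a * b ∈ I ^ (n + 1) := by
  rw [pow_succ']
  exact Ideal.mul_mem_mul ha hb

lemma IsTreeMonomial.extend {V R : Type*} [DecidableEq V] [CommRing R] {I : Ideal R}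
    {Z : V ⊕ V → R} {c : V → Bool} {t : ℕ} {s : Finset V} {u : R}
    (h : IsTreeMonomial I Z c t s u) {z w₀ : V} (hw₀ : w₀ ∈ s) (hc : c z ≠ c w₀)
    (hz : Z (Sum.inl z) * Z (Sum.inr z) ∈ I) (he : Z (Sum.inl z) * Z (Sum.inl w₀) ∈ I) :
    IsTreeMonomial I Z c (t + 1) (insert z s) (u * (Z (Sum.inl z) * Z (Sum.inl w₀))) := by
  have hmem : u * (Z (Sum.inl z) * Z (Sum.inl w₀)) ∈ I ^ (t + 1) := by
    rw [mul_comm]; exact Ideal.mul_mem_pow_succ he h.mem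
  have hold : ∀ β : V ⊕ V, Sum.elim id id β ∈ insert z s →
      Sum.elim id id β ∈ s ∨ β = Sum.inl z ∨ β = Sum.inr z := by
    rintro (j | j) hj <;> simp at hj ⊢ <;> tauto
  have hx : ∀ β : V ⊕ V, Sum.elim id id β ∈ insert z s → Sum.elim c (fun i => !c i) β = c w₀ →
      u * (Z (Sum.inl z) * Z (Sum.inl w₀)) * (Z (Sum.inl z) * Z β) ∈ I ^ (t + 1 + 1) := by
    intro β hβ hcβ
    rcases hold β hβ with hβ | rfl | rfl
    · obtain ⟨q, hq, hqe⟩ := h.same w₀ hw₀ β hβ hcβ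
      have := Ideal.mul_mem_pow_succ he (Ideal.mul_mem_pow_succ he hq)
      convert this using 1
      linear_combination (Z (Sum.inl z) * Z (Sum.inl w₀)) * Z (Sum.inl z) * hqe
    · exact absurd hcβ hc
    · convert Ideal.mul_mem_pow_succ hz hmem using 1
      ring
  have hy : ∀ β : V ⊕ V, Sum.elim id id β ∈ s → Sum.elim c (fun i => !c i) β ≠ c w₀ →
      u * (Z (Sum.inl z) * Z (Sum.inl w₀)) * (Z (Sum.inr z) * Z β) ∈ I ^ (t + 1 + 1) := by
    intro β hβ hcβ
    convert Ideal.mul_mem_pow_succ hz (h.opp (Sum.inl w₀) β hw₀ hβ hcβ.symm) using 1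
    ring
  have hcz : (!c z) = c w₀ := by cases h1 : c z <;> cases h2 : c w₀ <;> simp_all
  refine ⟨hmem, ?_, ?_, ?_⟩
  · intro w hw β hβ hcβ
    rcases Finset.mem_insert.1 hw with rfl | hw
    · rcases hold β hβ with hβ | rfl | rfl
      · exact ⟨u * (Z (Sum.inl w₀) * Z β), h.opp _ _ hw₀ hβ (by rw [hcβ]; exact hc.symm), by ring⟩
      · exact ⟨_, hmem, rfl⟩
      · simp at hcβ
    · rcases hold β hβ with hβ | rfl | rfl
      · obtain ⟨q, hq, hqe⟩ := h.same w hw β hβ hcβ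
        exact ⟨_, Ideal.mul_mem_pow_succ he hq, by
          linear_combination (Z (Sum.inl z) * Z (Sum.inl w₀)) * hqe⟩
      · obtain ⟨r, rfl, q, hq, hqe⟩ := h.dvd w hw w₀ hw₀ (by rw [← hcβ]; exact hc)
        exact ⟨_, Ideal.mul_mem_pow_succ he (Ideal.mul_mem_pow_succ he hq), by
          linear_combination Z (Sum.inl z) * (Z (Sum.inl z) * Z (Sum.inl w₀)) * hqe⟩
      · obtain ⟨q, hq, hqe⟩ := h.same w hw (Sum.inl w₀) hw₀ (by rw [← hcβ]; exact hcz.symm)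
        exact ⟨_, Ideal.mul_mem_pow_succ hz hq, by
          linear_combination Z (Sum.inl z) * Z (Sum.inr z) * hqe⟩
  · have hkey : ∀ α β : V ⊕ V, Sum.elim id id α ∉ s → Sum.elim id id α ∈ insert z s →
        Sum.elim id id β ∈ insert z s →
        Sum.elim c (fun i => !c i) α ≠ Sum.elim c (fun i => !c i) β →
        u * (Z (Sum.inl z) * Z (Sum.inl w₀)) * (Z α * Z β) ∈ I ^ (t + 1 + 1) := by
      intro α β hαs hα hβ hcαβ
      rcases hold α hα with h1 | rfl | rfl
      · exact absurd h1 hαs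
      · refine hx β hβ ?_
        rw [← hcz]
        exact Bool.eq_not.2 hcαβ.symm
      · rcases hold β hβ with hβ' | rfl | rfl
        · exact hy β hβ' (by rw [← hcz]; exact hcαβ.symm)
        · rw [mul_comm (Z (Sum.inr z))]
          exact hx _ (by simp) hcz
        · exact absurd rfl hcαβ
    intro α β hα hβ hcαβ
    by_cases hαs : Sum.elim id id α ∈ s
    · by_cases hβs : Sum.elim id id β ∈ s
      · convert Ideal.mul_mem_pow_succ he (h.opp α β hαs hβs hcαβ) using 1
        ring
      · rw [mul_comm (Z α)]
        exact hkey β α hβs hβ hα hcαβ.symm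
    · exact hkey α β hαs hα hβ hcαβ
  · have hkey : ∀ w ∈ s, c z ≠ c w → ∃ q ∈ I ^ t,
        u * (Z (Sum.inl z) * Z (Sum.inl w₀)) = Z (Sum.inl z) * Z (Sum.inl w) * q := by
      intro w hw hcw
      obtain ⟨q, hq, hqe⟩ := h.same w hw (Sum.inl w₀) hw₀ (by
        change c w₀ = c w; rw [← hcz, Bool.not_eq.2 hcw])
      exact ⟨q, hq, by linear_combination Z (Sum.inl z) * hqe⟩
    intro w hw w' hw' hcw
    rcases Finset.mem_insert.1 hw with rfl | hws
    · rcases Finset.mem_insert.1 hw' with rfl | hw'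
      · exact absurd rfl hcw
      · exact ⟨t, rfl, hkey w' hw' hcw⟩
    · rcases Finset.mem_insert.1 hw' with rfl | hw'
      · obtain ⟨q, hq, hqe⟩ := hkey w hws hcw.symm
        exact ⟨t, rfl, q, hq, by rw [hqe]; ring⟩
      · obtain ⟨r, rfl, q, hq, hqe⟩ := h.dvd w hws w' hw' hcw
        exact ⟨_, rfl, _, Ideal.mul_mem_pow_succ he hq, by
          linear_combination (Z (Sum.inl z) * Z (Sum.inl w₀)) * hqe⟩

lemma exists_isTreeMonomial {V k : Type} [Fintype V] [DecidableEq V] [Field k]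
    (T : SimpleGraph V) (hT : T.Connected) (c : V → Bool) (hc : ∀ i j, T.Adj i j → c i ≠ c j)
    (I : Ideal (MvPolynomial (V ⊕ V) k))
    (hI : ∀ i j, T.Adj i j → X (Sum.inl i) * X (Sum.inl j) ∈ I)
    (hI' : ∀ i, X (Sum.inl i) * X (Sum.inr i) ∈ I)
    (t : ℕ) (ht : t < Fintype.card V) :
    ∃ (s : Finset V) (m : V ⊕ V →₀ ℕ), s.card = t + 1 ∧
      (∀ W : V ⊕ V → ℕ, (∀ i ∈ s, W (Sum.inl i) = 1) → Finsupp.weight W m = 2 * t) ∧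
      IsTreeMonomial I X c t s (monomial m 1) := by
  induction t with
  | zero =>
    obtain ⟨v⟩ := hT.nonempty
    exact ⟨{v}, 0, by simp, by simp, IsTreeMonomial.singleton I _ c v (hI' v)⟩
  | succ t ih =>
    obtain ⟨s, m, hs, hm, h⟩ := ih (by lia)
    obtain ⟨w, hw⟩ : s.Nonempty := Finset.card_pos.1 (by lia)
    obtain ⟨z', hz'⟩ : sᶜ.Nonempty := Finset.card_pos.1 (by rw [Finset.card_compl]; lia)
    obtain ⟨p⟩ := hT.preconnected w z'
    obtain ⟨⟨⟨w₀, z⟩, hadj⟩, -, hw₀, hz⟩ := p.exists_boundary_dart (s : Set V) hw (by simpa using hz')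
    simp only [Finset.mem_coe] at hw₀ hz
    refine ⟨insert z s, m + (Finsupp.single (Sum.inl z) 1 + Finsupp.single (Sum.inl w₀) 1),
      by rw [Finset.card_insert_of_notMem hz, hs], ?_, ?_⟩
    · intro W hW
      rw [map_add, map_add, hm W fun i hi => hW i (Finset.mem_insert_of_mem hi),
        Finsupp.weight_single, Finsupp.weight_single, hW z (by simp), hW w₀ (by simp [hw₀])]
      simp; ring
    · have := h.extend hw₀ (hc _ _ hadj.symm) (hI' z) (hI _ _ hadj.symm)
      convert this using 1
      simp [X, monomial_mul]

lemma maxHomIdeal_isMaximal (k : Type) [Field k] (V : Type) : (maxHomIdeal k V).IsMaximal := by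
  have h : maxHomIdeal k V = RingHom.ker (constantCoeff (R := k) (σ := V)) := by
    refine le_antisymm (Ideal.span_le.2 ?_) fun p hp => ?_
    · rintro _ ⟨v, rfl⟩
      simp [RingHom.mem_ker]
    · rw [maxHomIdeal, ← Set.image_univ, mem_ideal_span_X_image]
      intro m hm
      by_contra! hm0
      obtain rfl : m = 0 := Finsupp.ext fun v => hm0 v trivial
      rw [mem_support_iff] at hm
      exact hm hp
  rw [h]
  exact RingHom.ker_isMaximal_of_surjective _ fun a => ⟨C a, by simp⟩

lemma le_weight_of_mem_support_mul {σ k : Type} [Field k] (W : σ → ℕ) {a b : ℕ}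
    {p q : MvPolynomial σ k} (hp : ∀ m ∈ p.support, a ≤ Finsupp.weight W m)
    (hq : ∀ m ∈ q.support, b ≤ Finsupp.weight W m) :
    ∀ m ∈ (p * q).support, a + b ≤ Finsupp.weight W m := by
  classical
  intro m hm
  obtain ⟨m₁, h₁, m₂, h₂, rfl⟩ := Finset.mem_add.1 (support_mul p q hm)
  rw [map_add]
  exact add_le_add (hp m₁ h₁) (hq m₂ h₂)

lemma le_weight_of_mem_pow {σ k : Type} [Field k] (W : σ → ℕ) {a : ℕ}
    {I : Ideal (MvPolynomial σ k)} (hI : ∀ p ∈ I, ∀ m ∈ p.support, a ≤ Finsupp.weight W m)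
    (n : ℕ) : ∀ p ∈ I ^ n, ∀ m ∈ p.support, a * n ≤ Finsupp.weight W m := by
  classical
  induction n with
  | zero => simp
  | succ n ih =>
    intro p hp
    rw [pow_succ] at hp
    induction hp using Submodule.mul_induction_on' with
    | mem_mul_mem p hp q hq => exact le_weight_of_mem_support_mul W (ih p hp) (hI q hq)
    | add p _ q _ hp hq =>
      intro m hm
      rcases Finset.mem_union.1 (support_add hm) with h | h
      exacts [hp m h, hq m h]

lemma le_weight_of_mem_edgeIdeal {V k : Type} [Field k] (G : SimpleGraph V) (W : V → ℕ) {a : ℕ}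
    (hW : ∀ i j, G.Adj i j → a ≤ W i + W j) :
    ∀ p ∈ edgeIdeal k G, ∀ m ∈ p.support, a ≤ Finsupp.weight W m := by
  classical
  intro p hp
  induction hp using Submodule.span_induction with
  | mem p hp =>
    obtain ⟨i, j, hij, rfl⟩ := hp
    have hX : ∀ v, ∀ m ∈ (X v : MvPolynomial V k).support, W v ≤ Finsupp.weight W m := by
      intro v m hm
      rw [support_X, Finset.mem_singleton] at hm
      simp [hm, Finsupp.weight_single]
    exact fun m hm => (hW i j hij).trans (le_weight_of_mem_support_mul W (hX i) (hX j) m hm)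
  | zero => simp
  | add p q _ _ hp hq =>
    intro m hm
    rcases Finset.mem_union.1 (support_add hm) with h | h
    exacts [hp m h, hq m h]
  | smul r p _ hp =>
    intro m hm
    have := le_weight_of_mem_support_mul W (a := 0) (p := r) (by simp) hp m hm
    simpa using this

lemma whiskerGraph_adj_inl {d : ℕ} {T : SimpleGraph (Fin d)} {i j : Fin d} (h : T.Adj i j) :
    (whiskerGraph T).Adj (Sum.inl i) (Sum.inl j) := by
  simp [whiskerGraph, h, h.ne]

lemma whiskerGraph_adj_inr {d : ℕ} (T : SimpleGraph (Fin d)) (i : Fin d) :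
    (whiskerGraph T).Adj (Sum.inl i) (Sum.inr i) := by
  simp [whiskerGraph]

lemma two_le_of_whiskerGraph_adj {d : ℕ} (T : SimpleGraph (Fin d)) (s : Finset (Fin d))
    (u v : Fin d ⊕ Fin d) (h : (whiskerGraph T).Adj u v) :
    let W : Fin d ⊕ Fin d → ℕ :=
      Sum.elim (fun i => if i ∈ s then 1 else 2) (fun i => if i ∈ s then 1 else 0)
    2 ≤ W u + W v := by
  rw [whiskerGraph, SimpleGraph.fromRel_adj] at h
  obtain ⟨-, (⟨i, j, -, rfl, rfl⟩ | ⟨i, rfl, rfl⟩) | (⟨i, j, -, rfl, rfl⟩ | ⟨i, rfl, rfl⟩)⟩ := h <;>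
  · simp only [Sum.elim_inl, Sum.elim_inr]
    split_ifs <;> lia

lemma not_forall_isZero_localCohomology (k : Type) [Field k] {d : ℕ} (T : SimpleGraph (Fin d))
    (hconn : T.Connected) (hacyc : T.IsAcyclic) {t : ℕ} (ht : t + 1 ≤ d) :
    ¬ ∀ i ≤ d - t, CategoryTheory.Limits.IsZero
      ((localCohomology (maxHomIdeal k (Fin d ⊕ Fin d)) i).obj
        (ModuleCat.of (MvPolynomial (Fin d ⊕ Fin d) k)
          (MvPolynomial (Fin d ⊕ Fin d) k ⧸ edgeIdeal k (whiskerGraph T) ^ (t + 1)))) := by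
  intro h
  have hmax := maxHomIdeal_isMaximal k (Fin d ⊕ Fin d)
  have hext := ext_eq_zero_of_localCohomology_isZero _ _ _ h
  have hI : ∀ u v, (whiskerGraph T).Adj u v → X u * X v ∈ edgeIdeal k (whiskerGraph T) :=
    fun u v huv => Ideal.subset_span ⟨u, v, huv, rfl⟩
  let col := hacyc.coloringTwo
  let c : Fin d → Bool := fun i => col i = 0
  have hc : ∀ i j, T.Adj i j → c i ≠ c j := by
    intro i j hij hcij
    have := col.valid hij
    simp only [c, decide_eq_decide] at hcij
    omega
  obtain ⟨s, m, hs, hm, hu⟩ := exists_isTreeMonomial T hconn c hc (edgeIdeal k (whiskerGraph T))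
    (fun i j hij => hI _ _ (whiskerGraph_adj_inl hij)) (fun i => hI _ _ (whiskerGraph_adj_inr T i))
    t (by simpa using ht)
  let χ : Fin d ⊕ Fin d → Bool := Sum.elim c (fun i => !c i)
  let A : Finset (Fin d ⊕ Fin d) := {v | Sum.elim id id v ∈ s ∧ χ v = true}
  let B : Finset (Fin d ⊕ Fin d) := {v | Sum.elim id id v ∈ s ∧ χ v = false}
  let D : Finset (Fin d ⊕ Fin d) := sᶜ.map Function.Embedding.inl
  let m' : Fin d ⊕ Fin d →₀ ℕ := ∑ j ∈ sᶜ, Finsupp.single (Sum.inr j) 1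
  have hcompl : (A ∪ B ∪ D)ᶜ = sᶜ.map Function.Embedding.inr := by
    ext (i | i) <;> cases hci : c i <;> simp [A, B, D, χ, hci]
  let W : Fin d ⊕ Fin d → ℕ :=
    Sum.elim (fun i => if i ∈ s then 1 else 2) (fun i => if i ∈ s then 1 else 0)
  have hweight : Finsupp.weight W (m + m') = 2 * t := by
    rw [map_add, hm W (fun i hi => by simp [W, hi]), map_sum, Finset.sum_eq_zero, add_zero]
    intro j hj
    have hj : j ∉ s := by simpa using hj
    simp [Finsupp.weight_single, W, hj]
  have hcoeff : ∀ v, Sum.elim id id v ∈ s → ∀ q ∈ edgeIdeal k (whiskerGraph T) ^ (t + 1),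
      coeff (Finsupp.single v 1 + (m + m')) q = 0 := by
    intro v hv q hq
    by_contra hne
    have := le_weight_of_mem_pow W (le_weight_of_mem_edgeIdeal (whiskerGraph T) W
      (two_le_of_whiskerGraph_adj T s)) (t + 1) q hq _ (mem_support_iff.2 hne)
    rw [map_add, hweight, Finsupp.weight_single] at this
    have hWv : W v = 1 := by rcases v with i | i <;> simp_all [W]
    simp only [hWv, smul_eq_mul] at this
    lia
  obtain ⟨f, hf0, hf⟩ := exists_smul_ext_eq_zero _ (d - t) hext (d - t - 1) 1 (by lia) (A ∪ B ∪ D)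
    (by rw [hcompl, Finset.card_map, Finset.card_compl, hs, Fintype.card_fin]; lia)
  obtain ⟨v, hv⟩ : s.Nonempty := Finset.card_pos.1 (by lia)
  obtain ⟨α, β, hα, hβ⟩ : ∃ α β, α ∈ A ∧ β ∈ B := by
    cases hcv : c v
    · exact ⟨Sum.inr v, Sum.inl v, by simp [A, χ, hv, hcv], by simp [B, χ, hv, hcv]⟩
    · exact ⟨Sum.inl v, Sum.inr v, by simp [A, χ, hv, hcv], by simp [B, χ, hv, hcv]⟩
  refine hf0 (constantCoeff_eq_zero_of_smul_ext_one_eq_zero _ A B D ?_ (m + m') ?_ ?_ α β hα hβ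
    ?_ ?_ f hf)
  · rw [Finset.disjoint_left]
    rintro (i | i) hi <;> simp [A, B, D] at hi ⊢ <;> tauto
  · intro a ha b hb
    have ha : Sum.elim id id a ∈ s ∧ χ a = true := by simpa [A] using ha
    have hb : Sum.elim id id b ∈ s ∧ χ b = false := by simpa [B] using hb
    have := hu.opp a b ha.1 hb.1 (by change χ a ≠ χ b; simp [ha.2, hb.2])
    convert Ideal.mul_mem_left _ (monomial m' 1) this using 1
    rw [← mul_assoc (monomial m' 1), monomial_mul, add_comm m', one_mul]
  · intro a ha
    obtain ⟨j, hj, rfl⟩ := Finset.mem_map.1 ha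
    have hm' : m' = Finsupp.single (Sum.inr j) 1 +
        ∑ j ∈ sᶜ.erase j, Finsupp.single (Sum.inr j) 1 := (Finset.add_sum_erase _ _ hj).symm
    have := Ideal.mul_mem_pow_succ (hI _ _ (whiskerGraph_adj_inr T j)) hu.mem
    convert Ideal.mul_mem_left _ (monomial (∑ j ∈ sᶜ.erase j, Finsupp.single (Sum.inr j) 1) 1)
      this using 1
    rw [hm']
    simp only [X, monomial_mul, Function.Embedding.inl_apply, mul_one]
    refine congrArg (fun n => monomial n (1 : k)) ?_
    abel
  · exact hcoeff α (by simpa [A] using (Finset.mem_filter.1 hα).2.1)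
  · exact hcoeff β (by simpa [B] using (Finset.mem_filter.1 hβ).2.1)

/-- Upper bound for depth of powers of edge ideals of Cohen-Macaulay trees: if `G` is the
whisker graph of a tree `T` on `d` vertices, then for `2 ≤ t ≤ d - 2` one has
`depth S/I(G)^{t+1} ≤ d - t`. -/
theorem depth_power_CM_tree_upper_bound (k : Type) [Field k] (d : ℕ)
    (T : SimpleGraph (Fin d)) (hconn : T.Connected) (hacyc : T.IsAcyclic) :
    ∀ t : ℕ, 2 ≤ t → (t : ℤ) ≤ (d : ℤ) - 2 →
      (depthQuot k ((edgeIdeal k (whiskerGraph T)) ^ (t + 1)) : ℤ) ≤ (d : ℤ) - t := by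
  intro t _ ht
  by_contra! hlt
  refine not_forall_isZero_localCohomology k T hconn hacyc (t := t) (by lia) fun i hi => ?_
  rw [ModuleCat.isZero_iff_subsingleton, ← not_nontrivial_iff_subsingleton]
  refine Nat.notMem_of_lt_sInf (s := {i : ℕ | Nontrivial ((localCohomology _ i).obj _)}) ?_
  change i < depthQuot k _
  lia
end
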